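/- arXiv:1512.04710 — 2 statements merged into one kernel-verified Lean document; each statement's English description precedes it below -/
import Mathlib

section
/- Let k be a field, n ≥ 3 an integer, and c : S₃ → k a function on the permutations of {1,2,3} such that for every a ∈ {1,2,3} there exists a permutation σ with σ(1) = a and c(σ) ≠ 0. Let A be the quotient of the free associative unital k-algebra on x₁,…,xₙ by the two-sided ideal generated by the n−2 cubic elements r_i = Σ_{σ∈S₃} c(σ)·x_{i−1+σ(1)} x_{i−1+σ(2)} x_{i−1+σ(3)}, for i = 1,…,n−2. Then the algebra A has global dimension 2: every left A-module has projective dimension at most 2, and there exists an A-module whose projective dimension is exactly 2. -/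
open scoped BigOperators

noncomputable section

universe u

/-- The generator index `i + t` (0-based): for the `i`-th relation (`i = 0,…,n-3`),
the letters involved are `x_i, x_{i+1}, x_{i+2}` (which, 1-based, are the letters
`x_{i'-1+1}, x_{i'-1+2}, x_{i'-1+3}` of the `i'`-th relation, `i' = 1,…,n-2`). -/
def genIdx (n : ℕ) (i : Fin (n - 2)) (t : Fin 3) : Fin n :=
  ⟨i.val + t.val, by have hi := i.isLt; have ht := t.isLt; omega⟩

/-- The cubic relation `r_i = Σ_{σ ∈ S₃} c(σ) · x_{i-1+σ(1)} x_{i-1+σ(2)} x_{i-1+σ(3)}`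
(written 0-based) in the free associative unital algebra `F = k⟨x_1,…,x_n⟩`. -/
def rel (k : Type) [Field k] (n : ℕ) (c : Equiv.Perm (Fin 3) → k) (i : Fin (n - 2)) :
    FreeAlgebra k (Fin n) :=
  ∑ σ : Equiv.Perm (Fin 3),
    c σ • (FreeAlgebra.ι k (genIdx n i (σ 0)) * FreeAlgebra.ι k (genIdx n i (σ 1)) *
      FreeAlgebra.ι k (genIdx n i (σ 2)))

/-- The relation identifying each `r_i` with `0`; quotienting the free algebra by (the ring
congruence generated by) this relation is exactly quotienting by the two-sided ideal
generated by `r_1,…,r_{n-2}`. -/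
def relRel (k : Type) [Field k] (n : ℕ) (c : Equiv.Perm (Fin 3) → k)
    (a b : FreeAlgebra k (Fin n)) : Prop :=
  b = 0 ∧ ∃ i : Fin (n - 2), a = rel k n c i

/-- The algebra `A = k⟨x_1,…,x_n⟩ / (r_1,…,r_{n-2})`. -/
abbrev QuotAlg (k : Type) [Field k] (n : ℕ) (c : Equiv.Perm (Fin 3) → k) : Type :=
  RingQuot (relRel k n c)

/-- The image `x̄_j` of the generator `x_j` in `A`. -/
def Xbar (k : Type) [Field k] (n : ℕ) (c : Equiv.Perm (Fin 3) → k) (j : Fin n) :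
    QuotAlg k n c :=
  RingQuot.mkAlgHom k (relRel k n c) (FreeAlgebra.ι k j)

/-- The element `p_{ij} = Σ_{σ ∈ S₃, i-1+σ(1) = j} c(σ) · x_{i-1+σ(2)} x_{i-1+σ(3)}` of the
free algebra (0-based), so that `r_i = Σ_j x_j p_{ij}`. -/
def pGen (k : Type) [Field k] (n : ℕ) (c : Equiv.Perm (Fin 3) → k) (i : Fin (n - 2))
    (j : Fin n) : FreeAlgebra k (Fin n) :=
  ∑ σ ∈ Finset.univ.filter (fun σ : Equiv.Perm (Fin 3) => genIdx n i (σ 0) = j),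
    c σ • (FreeAlgebra.ι k (genIdx n i (σ 1)) * FreeAlgebra.ι k (genIdx n i (σ 2)))

/-- The image `p̄_{ij}` of `p_{ij}` in `A`. -/
def Pbar (k : Type) [Field k] (n : ℕ) (c : Equiv.Perm (Fin 3) → k) (i : Fin (n - 2))
    (j : Fin n) : QuotAlg k n c :=
  RingQuot.mkAlgHom k (relRel k n c) (pGen k n c i j)

/-- The augmentation `ε : A → k`, the unique `k`-algebra map sending every `x̄_j` to `0`. -/
def aug (k : Type) [Field k] (n : ℕ) (c : Equiv.Perm (Fin 3) → k) :
    QuotAlg k n c →ₐ[k] k :=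
  RingQuot.liftAlgHom k ⟨FreeAlgebra.lift k (fun _ => (0 : k)), by
    rintro a b ⟨rfl, i, rfl⟩
    simp [rel, FreeAlgebra.lift_ι_apply]⟩

/-- The `A`-module `M` has projective dimension at most 2: there is an exact sequence
`0 → P₂ → P₁ → P₀ → M → 0` with all `Pᵢ` projective. -/
def HasProjDimLE2 (A : Type) [Ring A] (M : Type u) [AddCommGroup M] [Module A M] : Prop :=
  ∃ P₂ P₁ P₀ : ModuleCat.{u} A,
    Module.Projective A P₂ ∧ Module.Projective A P₁ ∧ Module.Projective A P₀ ∧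
    ∃ (f₂ : P₂ →ₗ[A] P₁) (f₁ : P₁ →ₗ[A] P₀) (f₀ : P₀ →ₗ[A] M),
      Function.Injective f₂ ∧
      LinearMap.range f₂ = LinearMap.ker f₁ ∧
      LinearMap.range f₁ = LinearMap.ker f₀ ∧
      Function.Surjective f₀

/-- The `A`-module `M` has projective dimension at most 1: there is an exact sequence
`0 → P₁ → P₀ → M → 0` with `P₀, P₁` projective. -/
def HasProjDimLE1 (A : Type) [Ring A] (M : Type u) [AddCommGroup M] [Module A M] : Prop :=
  ∃ P₁ P₀ : ModuleCat.{u} A,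
    Module.Projective A P₁ ∧ Module.Projective A P₀ ∧
    ∃ (f₁ : P₁ →ₗ[A] P₀) (f₀ : P₀ →ₗ[A] M),
      Function.Injective f₁ ∧
      LinearMap.range f₁ = LinearMap.ker f₀ ∧
      Function.Surjective f₀

section Presentation

variable {k : Type} [Field k] {n : ℕ} {c : Equiv.Perm (Fin 3) → k}

/-- A subspace containing `1` and stable under right multiplication by the generators is
everything. -/
theorem submodule_eq_top_of_mul_Xbar_mem (P : Submodule k (QuotAlg k n c)) (h1 : 1 ∈ P)
    (hX : ∀ a ∈ P, ∀ j, a * Xbar k n c j ∈ P) : P = ⊤ := by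
  have key : ∀ f : FreeAlgebra k (Fin n), ∀ a ∈ P,
      a * RingQuot.mkAlgHom k (relRel k n c) f ∈ P := by
    intro f
    induction f with
    | grade0 r =>
      intro a ha
      rw [AlgHom.commutes, ← Algebra.commutes, ← Algebra.smul_def]
      exact P.smul_mem _ ha
    | grade1 j => exact fun a ha => hX a ha j
    | mul f g hf hg =>
      intro a ha
      rw [map_mul, ← mul_assoc]
      exact hg _ (hf _ ha)
    | add f g hf hg =>
      intro a ha
      rw [map_add, mul_add]
      exact P.add_mem (hf _ ha) (hg _ ha)
  refine eq_top_iff.2 fun a _ => ?_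
  obtain ⟨f, rfl⟩ := RingQuot.mkAlgHom_surjective k (relRel k n c) a
  simpa using key f 1 h1

/-- The letter in position `t` of the monomial of `r_i` attached to `σ`. -/
abbrev letter (i : Fin (n - 2)) (σ : Equiv.Perm (Fin 3)) (t : Fin 3) : Fin n :=
  genIdx n i (σ t)

theorem Xbar_relation (i : Fin (n - 2)) :
    ∑ σ : Equiv.Perm (Fin 3), c σ • (Xbar k n c (letter i σ 0) * Xbar k n c (letter i σ 1) *
      Xbar k n c (letter i σ 2)) = 0 := by
  have h : RingQuot.mkAlgHom k (relRel k n c) (rel k n c i) = 0 := by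
    rw [RingQuot.mkAlgHom_rel k (show relRel k n c (rel k n c i) 0 from ⟨rfl, i, rfl⟩), map_zero]
  simp only [rel, map_sum, map_smul, map_mul] at h
  exact h

/-- Existence of a twisted derivation with values in a space carrying right operators `T` and
initial data `η`, provided that these are compatible with the relations. -/
theorem exists_twisted_derivation {N : Type*} [AddCommGroup N] [Module k N]
    (T : Fin n → N →ₗ[k] N) (η : Fin n → QuotAlg k n c →ₗ[k] N)
    (hT : ∀ i x, ∑ σ : Equiv.Perm (Fin 3),
      c σ • T (letter i σ 2) (T (letter i σ 1) (T (letter i σ 0) x)) = 0)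
    (hη : ∀ i a, ∑ σ : Equiv.Perm (Fin 3), c σ •
      (T (letter i σ 2) (T (letter i σ 1) (η (letter i σ 0) a)) +
        T (letter i σ 2) (η (letter i σ 1) (a * Xbar k n c (letter i σ 0))) +
        η (letter i σ 2) (a * Xbar k n c (letter i σ 0) * Xbar k n c (letter i σ 1))) = 0) :
    ∃ δ : QuotAlg k n c →ₗ[k] N, δ 1 = 0 ∧
      ∀ a j, δ (a * Xbar k n c j) = T j (δ a) + η j a := by
  let R : Fin n → Module.End k (QuotAlg k n c × N) := fun j =>
    ((LinearMap.mulRight k (Xbar k n c j)).comp (LinearMap.fst k _ _)).prod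
      ((T j).comp (LinearMap.snd k _ _) + (η j).comp (LinearMap.fst k _ _))
  have hR : ∀ j a x, R j (a, x) = (a * Xbar k n c j, T j x + η j a) := fun _ _ _ => rfl
  let φ : FreeAlgebra k (Fin n) →ₐ[k] (Module.End k (QuotAlg k n c × N))ᵐᵒᵖ :=
    FreeAlgebra.lift k fun j => MulOpposite.op (R j)
  have hφ : ∀ ⦃f g : FreeAlgebra k (Fin n)⦄, relRel k n c f g → φ f = φ g := by
    rintro f g ⟨rfl, i, rfl⟩
    apply MulOpposite.unop_injective
    refine LinearMap.ext fun z => ?_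
    obtain ⟨a, x⟩ := z
    simp only [φ, rel, map_sum, map_smul, map_mul, map_zero, FreeAlgebra.lift_ι_apply,
      ← MulOpposite.op_mul, ← MulOpposite.op_smul, Finset.unop_sum, MulOpposite.unop_op,
      MulOpposite.unop_zero]
    rw [LinearMap.sum_apply]
    simp only [LinearMap.smul_apply, Module.End.mul_apply, hR, Prod.smul_mk, LinearMap.zero_apply]
    rw [Prod.ext_iff, Prod.fst_sum, Prod.snd_sum]
    refine ⟨?_, ?_⟩
    · have h := congrArg (a * ·) (Xbar_relation (k := k) (c := c) i)
      simpa [Finset.mul_sum, mul_assoc] using h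
    · have h := congrArg₂ (· + ·) (hT i x) (hη i a)
      simpa [← Finset.sum_add_distrib, ← smul_add, add_assoc] using h
  let ψ := RingQuot.liftAlgHom k ⟨φ, hφ⟩
  have hψ : ∀ a j z, (ψ (a * Xbar k n c j)).unop z = R j ((ψ a).unop z) := by
    intro a j z
    have : ψ (Xbar k n c j) = MulOpposite.op (R j) := by
      simp [ψ, Xbar, φ]
    rw [map_mul, this]
    rfl
  let ev : QuotAlg k n c →ₗ[k] QuotAlg k n c × N :=
    (LinearMap.applyₗ ((1, 0) : QuotAlg k n c × N)).comp
      ((MulOpposite.opLinearEquiv k).symm.toLinearMap.comp ψ.toLinearMap)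
  have hev : ∀ a, ev a = (ψ a).unop (1, 0) := fun _ => rfl
  have hfst : ∀ a, (ev a).1 = a := by
    have h := submodule_eq_top_of_mul_Xbar_mem
      (LinearMap.eqLocus ((LinearMap.fst k _ _).comp ev) LinearMap.id)
      (by simp [LinearMap.mem_eqLocus, hev]) (by
        intro a ha j
        rw [LinearMap.mem_eqLocus] at ha ⊢
        simp only [LinearMap.comp_apply, LinearMap.fst_apply, LinearMap.id_apply] at ha ⊢
        rw [hev, hψ, ← hev, ← Prod.mk.eta (p := ev a), hR, ha])
    intro a
    have : a ∈ (⊤ : Submodule k (QuotAlg k n c)) := trivial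
    rw [← h] at this
    exact this
  refine ⟨(LinearMap.snd k _ _).comp ev, by simp [hev], fun a j => ?_⟩
  simp only [LinearMap.comp_apply, LinearMap.snd_apply]
  rw [hev, hψ, ← hev, ← Prod.mk.eta (p := ev a), hR, hfst]

end Presentation

section Pivot

/-- The pivot letters: every window `{i, i + 1, i + 2}` contains exactly one of them. -/
def IsPivot {n : ℕ} (j : Fin n) : Prop := j.val % 3 = 2

instance {n : ℕ} : DecidablePred (IsPivot (n := n)) := fun j =>
  inferInstanceAs (Decidable (j.val % 3 = 2))

/-- The position of the pivot letter in the `i`-th window. -/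
def pivotPos {n : ℕ} (i : Fin (n - 2)) : Fin 3 :=
  ⟨2 - i.val % 3, by omega⟩

theorem isPivot_genIdx_iff {n : ℕ} (i : Fin (n - 2)) (t : Fin 3) :
    IsPivot (genIdx n i t) ↔ t = pivotPos i := by
  simp only [IsPivot, genIdx, pivotPos, Fin.ext_iff]
  omega

theorem letter_inj {n : ℕ} {i i' : Fin (n - 2)} {σ τ : Equiv.Perm (Fin 3)}
    (h : ∀ t, letter i σ t = letter i' τ t) : i = i' ∧ σ = τ := by
  have hs : ∀ ρ : Equiv.Perm (Fin 3), (ρ 0).val + (ρ 1).val + (ρ 2).val = 3 := by decide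
  have hv : ∀ t, i.val + (σ t).val = i'.val + (τ t).val := fun t => congrArg Fin.val (h t)
  have h0 := hv 0
  have h1 := hv 1
  have h2 := hv 2
  have hσ := hs σ
  have hτ := hs τ
  have hi : i = i' := Fin.ext (by omega)
  refine ⟨hi, Equiv.ext fun t => Fin.ext ?_⟩
  have := hv t
  rw [hi] at this
  omega

theorem perm_cases_pivot {σ : Equiv.Perm (Fin 3)} (p : Fin 3) :
    (σ 0 = p ∧ σ 1 ≠ p ∧ σ 2 ≠ p) ∨ (σ 0 ≠ p ∧ σ 1 = p ∧ σ 2 ≠ p) ∨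
      (σ 0 ≠ p ∧ σ 1 ≠ p ∧ σ 2 = p) := by
  revert σ p
  decide

theorem add_smul_neg_inv_smul {K V : Type*} [Field K] [AddCommGroup V] [Module K V] {r : K}
    (hr : r ≠ 0) (x : V) : x + r • -r⁻¹ • x = 0 := by
  rw [smul_smul, mul_neg, mul_inv_cancel₀ hr, neg_one_smul, add_neg_cancel]

variable {k : Type} [Field k] {n : ℕ} {c : Equiv.Perm (Fin 3) → k}

/-- The span of the words with fewer than `m` pivot letters. -/
def pivotFiltration (k : Type) [Field k] (n : ℕ) (c : Equiv.Perm (Fin 3) → k) (m : ℕ) :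
    Submodule k (QuotAlg k n c) :=
  Submodule.span k {a | ∃ l : List (Fin n), l.countP (fun j => decide (IsPivot j)) < m ∧
    a = (l.map (Xbar k n c)).prod}

theorem pivotFiltration_zero : pivotFiltration k n c 0 = ⊥ := by
  simp [pivotFiltration]

theorem pivotFiltration_mono : Monotone (pivotFiltration k n c) := by
  intro m m' h
  refine Submodule.span_mono ?_
  rintro a ⟨l, hl, rfl⟩
  exact ⟨l, hl.trans_le h, rfl⟩

theorem mul_Xbar_mem_pivotFiltration {m : ℕ} {a : QuotAlg k n c}
    (ha : a ∈ pivotFiltration k n c m) (j : Fin n) :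
    a * Xbar k n c j ∈ pivotFiltration k n c (if IsPivot j then m + 1 else m) := by
  have : pivotFiltration k n c m ≤ (pivotFiltration k n c (if IsPivot j then m + 1 else m)).comap
      (LinearMap.mulRight k (Xbar k n c j)) := by
    refine Submodule.span_le.2 ?_
    rintro _ ⟨l, hl, rfl⟩
    refine Submodule.subset_span ⟨l ++ [j], ?_, by simp⟩
    by_cases hj : IsPivot j <;> simp [List.countP_append, hj, hl]
  exact this ha

theorem mul_Xbar_mem_pivotFiltration_of_not {m : ℕ} {a : QuotAlg k n c}
    (ha : a ∈ pivotFiltration k n c m) {j : Fin n} (hj : ¬ IsPivot j) :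
    a * Xbar k n c j ∈ pivotFiltration k n c m := by
  simpa [hj] using mul_Xbar_mem_pivotFiltration ha j

theorem exists_mem_pivotFiltration (a : QuotAlg k n c) :
    ∃ m, a ∈ pivotFiltration k n c m := by
  have hd : Directed (· ≤ ·) (pivotFiltration k n c) := pivotFiltration_mono.directed_le
  have h := submodule_eq_top_of_mul_Xbar_mem (⨆ m, pivotFiltration k n c m)
    ((Submodule.mem_iSup_of_directed _ hd).2 ⟨1, Submodule.subset_span ⟨[], by simp, by simp⟩⟩)
    (fun a ha j => by
      obtain ⟨m, hm⟩ := (Submodule.mem_iSup_of_directed _ hd).1 ha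
      exact (Submodule.mem_iSup_of_directed _ hd).2 ⟨_, mul_Xbar_mem_pivotFiltration hm j⟩)
  refine (Submodule.mem_iSup_of_directed _ hd).1 ?_
  rw [h]
  trivial

/-- The target of the extraction derivation: coefficients of the pivot letters, and of the
words consisting of a pivot letter and one further letter. -/
abbrev Tail (k : Type) [Field k] (n : ℕ) (c : Equiv.Perm (Fin 3) → k) : Type :=
  (Fin n → QuotAlg k n c) × (Fin n → Fin n → QuotAlg k n c)

/-- The element `a ⊗ y` of `Tail`. -/
def tailOne (y : Fin n) : QuotAlg k n c →ₗ[k] Tail k n c :=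
  (LinearMap.inl k _ _).comp (LinearMap.single k (fun _ => QuotAlg k n c) y)

/-- The element `a ⊗ y z` of `Tail`. -/
def tailTwo (y z : Fin n) : QuotAlg k n c →ₗ[k] Tail k n c :=
  (LinearMap.inr k _ _).comp
    ((LinearMap.single k (fun _ => Fin n → QuotAlg k n c) y).comp
      (LinearMap.single k (fun _ => QuotAlg k n c) z))

/-- The coefficient of `y`. -/
def tailCoeffOne (y : Fin n) : Tail k n c →ₗ[k] QuotAlg k n c :=
  (LinearMap.proj (φ := fun _ : Fin n => QuotAlg k n c) y).comp (LinearMap.fst k _ _)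

/-- The coefficient of `y z`. -/
def tailCoeffTwo (y z : Fin n) : Tail k n c →ₗ[k] QuotAlg k n c :=
  (LinearMap.proj (φ := fun _ : Fin n => QuotAlg k n c) z).comp
    ((LinearMap.proj (φ := fun _ : Fin n => Fin n → QuotAlg k n c) y).comp (LinearMap.snd k _ _))

@[simp] theorem tailCoeffOne_tailOne (y y' : Fin n) (a : QuotAlg k n c) :
    tailCoeffOne y (tailOne y' a) = if y = y' then a else 0 := by
  simp [tailCoeffOne, tailOne, Pi.single_apply]

@[simp] theorem tailCoeffTwo_tailOne (y z y' : Fin n) (a : QuotAlg k n c) :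
    tailCoeffTwo y z (tailOne y' a) = 0 := by
  simp [tailCoeffTwo, tailOne]

@[simp] theorem tailCoeffOne_tailTwo (y y' z' : Fin n) (a : QuotAlg k n c) :
    tailCoeffOne y (tailTwo y' z' a) = 0 := by
  simp [tailCoeffOne, tailTwo]

@[simp] theorem tailCoeffTwo_tailTwo (y z y' z' : Fin n) (a : QuotAlg k n c) :
    tailCoeffTwo y z (tailTwo y' z' a) = if y = y' ∧ z = z' then a else 0 := by
  by_cases hy : y = y' <;> by_cases hz : z = z' <;>
    simp [tailCoeffTwo, tailTwo, hy, hz]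

/-- Elements of `Tail` all of whose coefficients lie in the `m`-th step of the filtration. -/
def tailFiltration (k : Type) [Field k] (n : ℕ) (c : Equiv.Perm (Fin 3) → k) (m : ℕ) :
    Submodule k (Tail k n c) :=
  (⨅ y, (pivotFiltration k n c m).comap (tailCoeffOne y)) ⊓
    ⨅ y, ⨅ z, (pivotFiltration k n c m).comap (tailCoeffTwo y z)

theorem mem_tailFiltration {m : ℕ} {x : Tail k n c} : x ∈ tailFiltration k n c m ↔
    (∀ y, tailCoeffOne y x ∈ pivotFiltration k n c m) ∧
      ∀ y z, tailCoeffTwo y z x ∈ pivotFiltration k n c m := by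
  simp [tailFiltration, Submodule.mem_iInf]

theorem tailOne_mem {m : ℕ} {a : QuotAlg k n c} (ha : a ∈ pivotFiltration k n c m) (y : Fin n) :
    tailOne y a ∈ tailFiltration k n c m := by
  refine mem_tailFiltration.2 ⟨fun y' => ?_, fun y' z => ?_⟩
  · rw [tailCoeffOne_tailOne]
    split_ifs
    exacts [ha, zero_mem _]
  · simp

theorem tailTwo_mem {m : ℕ} {a : QuotAlg k n c} (ha : a ∈ pivotFiltration k n c m)
    (y z : Fin n) : tailTwo y z a ∈ tailFiltration k n c m := by
  refine mem_tailFiltration.2 ⟨fun y' => ?_, fun y' z' => ?_⟩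
  · simp
  · rw [tailCoeffTwo_tailTwo]
    split_ifs
    exacts [ha, zero_mem _]

/-- The part of `a r_i` in which the pivot letter is not the first letter of the relation. -/
def lowerPart (i : Fin (n - 2)) : QuotAlg k n c →ₗ[k] Tail k n c :=
  ∑ σ : Equiv.Perm (Fin 3), c σ •
    if σ 2 = pivotPos i then
      (tailOne (letter i σ 2)).comp (LinearMap.mulRight k
        (Xbar k n c (letter i σ 0) * Xbar k n c (letter i σ 1)))
    else if σ 1 = pivotPos i then
      (tailTwo (letter i σ 1) (letter i σ 2)).comp (LinearMap.mulRight k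
        (Xbar k n c (letter i σ 0)))
    else 0

theorem lowerPart_mem {m : ℕ} {a : QuotAlg k n c} (ha : a ∈ pivotFiltration k n c m)
    (i : Fin (n - 2)) : lowerPart i a ∈ tailFiltration k n c m := by
  rw [lowerPart, LinearMap.sum_apply]
  refine Submodule.sum_mem _ fun σ _ => ?_
  rw [LinearMap.smul_apply]
  refine Submodule.smul_mem _ _ ?_
  have hp : ∀ t, ¬ σ t = pivotPos i → ¬ IsPivot (letter i σ t) := fun t ht => by
    rwa [isPivot_genIdx_iff]
  rcases perm_cases_pivot (σ := σ) (pivotPos i) with ⟨h0, h1, h2⟩ | ⟨h0, h1, h2⟩ | ⟨h0, h1, h2⟩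
  · rw [if_neg h2, if_neg h1]
    exact zero_mem _
  · rw [if_neg h2, if_pos h1]
    exact tailTwo_mem (mul_Xbar_mem_pivotFiltration_of_not ha (hp 0 h0)) _ _
  · rw [if_pos h2]
    refine tailOne_mem ?_ _
    rw [LinearMap.mulRight_apply, ← mul_assoc]
    exact mul_Xbar_mem_pivotFiltration_of_not
      (mul_Xbar_mem_pivotFiltration_of_not ha (hp 0 h0)) (hp 1 h1)

/-- Right multiplication by a letter on `Tail`, where `s i` is the leading monomial of `r_i`;
non-leading words of length three are set to zero. -/
def tailMul (s : Fin (n - 2) → Equiv.Perm (Fin 3)) (j : Fin n) : Tail k n c →ₗ[k] Tail k n c :=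
  if IsPivot j then 0 else
    ∑ y, (tailTwo y j).comp (tailCoeffOne y) +
    ∑ i, if letter i (s i) 2 = j then
      (-(c (s i))⁻¹) • (lowerPart i).comp (tailCoeffTwo (letter i (s i) 0) (letter i (s i) 1))
    else 0

theorem tailMul_of_isPivot (s : Fin (n - 2) → Equiv.Perm (Fin 3)) {j : Fin n} (hj : IsPivot j)
    (x : Tail k n c) : tailMul s j x = 0 := by
  simp [tailMul, hj]

theorem tailMul_tailOne (s : Fin (n - 2) → Equiv.Perm (Fin 3)) {j : Fin n} (hj : ¬ IsPivot j)
    (y : Fin n) (a : QuotAlg k n c) : tailMul s j (tailOne y a) = tailTwo y j a := by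
  have h : ∀ i, (if letter i (s i) 2 = j then
      (-(c (s i))⁻¹) • (lowerPart i).comp (tailCoeffTwo (letter i (s i) 0) (letter i (s i) 1))
      else (0 : Tail k n c →ₗ[k] Tail k n c)) (tailOne y a) = 0 := by
    intro i
    split_ifs <;> simp
  rw [tailMul, if_neg hj, LinearMap.add_apply, LinearMap.sum_apply, LinearMap.sum_apply,
    Finset.sum_eq_zero fun i _ => h i, add_zero, Finset.sum_eq_single y]
  · simp
  · intro y' _ hy'
    simp [hy']
  · simp

theorem tailMul_tailTwo (s : Fin (n - 2) → Equiv.Perm (Fin 3)) (i : Fin (n - 2))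
    (σ : Equiv.Perm (Fin 3)) (hσ : σ 0 = pivotPos i) (a : QuotAlg k n c) :
    tailMul s (letter i σ 2) (tailTwo (letter i σ 0) (letter i σ 1) a) =
      if σ = s i then (-(c (s i))⁻¹) • lowerPart i a else 0 := by
  have hj : ¬ IsPivot (letter i σ 2) := by
    rw [isPivot_genIdx_iff, ← hσ]
    exact fun h => absurd (σ.injective h) (by decide)
  have h : ∀ i', (if letter i' (s i') 2 = letter i σ 2 then
      (-(c (s i'))⁻¹) • (lowerPart i').comp
        (tailCoeffTwo (letter i' (s i') 0) (letter i' (s i') 1))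
      else (0 : Tail k n c →ₗ[k] Tail k n c)) (tailTwo (letter i σ 0) (letter i σ 1) a) =
      if i' = i ∧ s i' = σ then (-(c (s i'))⁻¹) • lowerPart i' a else 0 := by
    intro i'
    by_cases h2 : letter i' (s i') 2 = letter i σ 2
    · rw [if_pos h2, LinearMap.smul_apply, LinearMap.comp_apply, tailCoeffTwo_tailTwo]
      by_cases h01 : letter i' (s i') 0 = letter i σ 0 ∧ letter i' (s i') 1 = letter i σ 1
      · have := letter_inj (i := i') (i' := i) (σ := s i') (τ := σ) (fun t => by
          fin_cases t
          exacts [h01.1, h01.2, h2])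
        rw [if_pos h01, if_pos this]
      · rw [if_neg h01, if_neg, map_zero, smul_zero]
        rintro ⟨rfl, rfl⟩
        exact h01 ⟨rfl, rfl⟩
    · rw [if_neg h2, if_neg, LinearMap.zero_apply]
      rintro ⟨rfl, rfl⟩
      exact h2 rfl
  rw [tailMul, if_neg hj, LinearMap.add_apply, LinearMap.sum_apply, LinearMap.sum_apply,
    Finset.sum_congr rfl fun i' _ => h i', Finset.sum_eq_zero (by simp), zero_add,
    Finset.sum_eq_single i]
  · by_cases hs : σ = s i
    · simp [hs]
    · simp [hs, Ne.symm hs]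
  · intro i' _ hi'
    simp [hi']
  · simp

theorem tailMul_mem (s : Fin (n - 2) → Equiv.Perm (Fin 3)) {m : ℕ} {x : Tail k n c}
    (hx : x ∈ tailFiltration k n c m) (j : Fin n) : tailMul s j x ∈ tailFiltration k n c m := by
  rw [mem_tailFiltration] at hx
  by_cases hj : IsPivot j
  · rw [tailMul_of_isPivot s hj]
    exact zero_mem _
  · rw [tailMul, if_neg hj, LinearMap.add_apply, LinearMap.sum_apply, LinearMap.sum_apply]
    refine add_mem (Submodule.sum_mem _ fun y _ => tailTwo_mem (hx.1 y) _ _)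
      (Submodule.sum_mem _ fun i _ => ?_)
    split_ifs
    · exact Submodule.smul_mem _ _ (lowerPart_mem (hx.2 _ _) i)
    · exact zero_mem _

/-- The operators extracting from `a y z` its left factor `a`, where `y z` is the beginning of
the leading monomial of a relation. -/
theorem exists_extraction (s : Fin (n - 2) → Equiv.Perm (Fin 3))
    (hs : ∀ i, s i 0 = pivotPos i) (hc : ∀ i, c (s i) ≠ 0) :
    ∃ D : Fin (n - 2) → QuotAlg k n c →ₗ[k] QuotAlg k n c,
      (∀ i j a, IsPivot j → D i (a * Xbar k n c j) = 0) ∧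
      (∀ i y z a, IsPivot y → ¬ IsPivot z → D i (a * Xbar k n c y * Xbar k n c z) =
        if letter i (s i) 0 = y ∧ letter i (s i) 1 = z then a else 0) ∧
      (∀ i m, ∀ a ∈ pivotFiltration k n c (m + 1), D i a ∈ pivotFiltration k n c m) := by
  obtain ⟨δ, h1, hδ⟩ := exists_twisted_derivation (k := k) (c := c) (tailMul s)
    (fun j => if IsPivot j then tailOne j else 0) (by
      intro i x
      refine Finset.sum_eq_zero fun σ _ => ?_
      have hp : ∀ t, σ t = pivotPos i → IsPivot (letter i σ t) := fun t ht => by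
        rwa [isPivot_genIdx_iff]
      rcases perm_cases_pivot (σ := σ) (pivotPos i) with ⟨h, -, -⟩ | ⟨-, h, -⟩ | ⟨-, -, h⟩ <;>
        simp [tailMul_of_isPivot s (hp _ h)]) (by
      intro i a
      have hp : ∀ σ : Equiv.Perm (Fin 3), ∀ t, σ t = pivotPos i → IsPivot (letter i σ t) :=
        fun σ t ht => by rwa [isPivot_genIdx_iff]
      have hnp : ∀ σ : Equiv.Perm (Fin 3), ∀ t, σ t ≠ pivotPos i → ¬ IsPivot (letter i σ t) :=
        fun σ t ht => by rwa [isPivot_genIdx_iff]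
      have key : lowerPart i a + ∑ σ : Equiv.Perm (Fin 3), c σ •
          (if σ = s i then (-(c (s i))⁻¹) • lowerPart i a else 0) = 0 := by
        simp only [smul_ite, smul_zero, Finset.sum_ite_eq', Finset.mem_univ, if_true]
        exact add_smul_neg_inv_smul (hc i) _
      rw [lowerPart, LinearMap.sum_apply, ← Finset.sum_add_distrib] at key
      rw [← key]
      refine Finset.sum_congr rfl fun σ _ => ?_
      rw [LinearMap.smul_apply, ← smul_add]
      congr 1
      rcases perm_cases_pivot (σ := σ) (pivotPos i) with
        ⟨h0, h1, h2⟩ | ⟨h0, h1, h2⟩ | ⟨h0, h1, h2⟩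
      · rw [if_neg (hnp σ 1 h1), if_neg (hnp σ 2 h2), if_pos (hp σ 0 h0), if_neg h2, if_neg h1,
          tailMul_tailOne s (hnp σ 1 h1), tailMul_tailTwo s i σ h0]
        simp [lowerPart]
      · have hne : σ ≠ s i := by
          rintro rfl
          exact h0 (hs i)
        rw [if_neg (hnp σ 0 h0), if_neg (hnp σ 2 h2), if_pos (hp σ 1 h1), if_neg h2, if_pos h1,
          tailMul_tailOne s (hnp σ 2 h2), if_neg hne]
        simp
      · have hne : σ ≠ s i := by
          rintro rfl
          exact h0 (hs i)
        rw [if_neg (hnp σ 0 h0), if_neg (hnp σ 1 h1), if_pos (hp σ 2 h2), if_pos h2, if_neg hne]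
        simp [mul_assoc])
  refine ⟨fun i => (tailCoeffTwo (letter i (s i) 0) (letter i (s i) 1)).comp δ, ?_, ?_, ?_⟩
  · intro i j a hj
    simp [hδ, hj, tailMul_of_isPivot s hj]
  · intro i y z a hy hz
    simp [hδ, hy, hz, tailMul_of_isPivot s hy, tailMul_tailOne s hz]
  · intro i m a ha
    have hle : pivotFiltration k n c (m + 1) ≤ (tailFiltration k n c m).comap δ := by
      refine Submodule.span_le.2 ?_
      rintro _ ⟨l, hl, rfl⟩
      have hword : δ (l.map (Xbar k n c)).prod ∈
          tailFiltration k n c (l.countP fun j => decide (IsPivot j)) := by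
        clear hl
        induction l using List.reverseRecOn with
        | nil => simp [h1]
        | append_singleton l j ih =>
          rw [List.map_append, List.prod_append, List.map_singleton, List.prod_singleton, hδ]
          by_cases hj : IsPivot j
          · rw [tailMul_of_isPivot s hj, zero_add, if_pos hj]
            refine tailOne_mem (Submodule.subset_span ⟨l, ?_, rfl⟩) _
            simp [List.countP_append, hj]
          · simpa [List.countP_append, hj] using tailMul_mem s ih j
      have hmono : tailFiltration k n c (l.countP fun j => decide (IsPivot j)) ≤
          tailFiltration k n c m := by
        intro x hx
        rw [mem_tailFiltration] at hx ⊢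
        have hG := pivotFiltration_mono (k := k) (n := n) (c := c) (Nat.lt_succ_iff.1 hl)
        exact ⟨fun y => hG (hx.1 y), fun y z => hG (hx.2 y z)⟩
      exact hmono hword
    exact (mem_tailFiltration.1 (hle ha)).2 _ _

end Pivot

section Resolution

open TensorProduct

variable {k : Type} [Field k] {n : ℕ} {c : Equiv.Perm (Fin 3) → k}
  {A : Type} [Ring A] [Algebra k A] (e : QuotAlg k n c ≃ₐ[k] A)

/-- The generators of an algebra identified with `QuotAlg k n c`. -/
def gen (j : Fin n) : A := e (Xbar k n c j)

theorem submodule_eq_top_of_mul_gen_mem (P : Submodule k A) (h1 : 1 ∈ P)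
    (hX : ∀ a ∈ P, ∀ j, a * gen e j ∈ P) : P = ⊤ := by
  have h := submodule_eq_top_of_mul_Xbar_mem (P.comap e.toLinearMap) (by simpa using h1)
    (fun a ha j => by simpa [gen] using hX _ ha j)
  refine eq_top_iff.2 fun a _ => ?_
  have ha : e.symm a ∈ P.comap e.toLinearMap := by
    rw [h]
    trivial
  simpa using ha

theorem gen_relation (i : Fin (n - 2)) :
    ∑ σ : Equiv.Perm (Fin 3), c σ • (gen e (letter i σ 0) * gen e (letter i σ 1) *
      gen e (letter i σ 2)) = 0 := by
  have h := congrArg e (Xbar_relation (k := k) (c := c) i)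
  simp only [map_sum, map_smul, map_mul, map_zero] at h
  exact h

theorem exists_twisted_derivation_gen {N : Type*} [AddCommGroup N] [Module k N]
    (T : Fin n → N →ₗ[k] N) (η : Fin n → A →ₗ[k] N)
    (hT : ∀ i x, ∑ σ : Equiv.Perm (Fin 3),
      c σ • T (letter i σ 2) (T (letter i σ 1) (T (letter i σ 0) x)) = 0)
    (hη : ∀ i a, ∑ σ : Equiv.Perm (Fin 3), c σ •
      (T (letter i σ 2) (T (letter i σ 1) (η (letter i σ 0) a)) +
        T (letter i σ 2) (η (letter i σ 1) (a * gen e (letter i σ 0))) +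
        η (letter i σ 2) (a * gen e (letter i σ 0) * gen e (letter i σ 1))) = 0) :
    ∃ δ : A →ₗ[k] N, δ 1 = 0 ∧ ∀ a j, δ (a * gen e j) = T j (δ a) + η j a := by
  obtain ⟨δ, h1, hδ⟩ := exists_twisted_derivation T (fun j => (η j).comp e.toLinearMap) hT
    (fun i a => by simpa [gen] using hη i (e a))
  refine ⟨δ.comp e.symm.toLinearMap, by simpa using h1, fun a j => ?_⟩
  simpa [gen] using hδ (e.symm a) j

/-- The extraction operators, with the filtration they lower. -/
theorem exists_extraction_gen (s : Fin (n - 2) → Equiv.Perm (Fin 3))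
    (hs : ∀ i, s i 0 = pivotPos i) (hc : ∀ i, c (s i) ≠ 0) :
    ∃ (G : ℕ → Submodule k A) (D : Fin (n - 2) → A →ₗ[k] A),
      G 0 = ⊥ ∧ Monotone G ∧ (∀ a, ∃ m, a ∈ G m) ∧
      (∀ i m, ∀ a ∈ G (m + 1), D i a ∈ G m) ∧
      (∀ i m j, ∀ a ∈ G (m + 1), D i (a * gen e j) ∈ G m) ∧
      (∀ i i' σ a, letter i' σ 2 = letter i (s i) 2 →
        D i (a * gen e (letter i' σ 0) * gen e (letter i' σ 1)) =
          if i' = i ∧ σ = s i then a else 0) := by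
  obtain ⟨D, hD1, hD2, hD3⟩ := exists_extraction s hs hc
  refine ⟨fun m => (pivotFiltration k n c m).comap e.symm.toLinearMap,
    fun i => e.toLinearMap.comp ((D i).comp e.symm.toLinearMap), ?_, ?_, ?_, ?_, ?_, ?_⟩
  · ext a
    simp [pivotFiltration_zero]
  · exact fun m m' h => Submodule.comap_mono (pivotFiltration_mono h)
  · exact fun a => exists_mem_pivotFiltration (e.symm a)
  · intro i m a ha
    simpa using hD3 i m _ ha
  · intro i m j a ha
    by_cases hj : IsPivot j
    · simp [gen, hD1 i j _ hj]
    · simpa [gen] using hD3 i m _ (mul_Xbar_mem_pivotFiltration_of_not ha hj)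
  · intro i i' σ a h2
    have hnp : ¬ IsPivot (letter i' σ 2) := by
      rw [h2, isPivot_genIdx_iff, ← hs i]
      exact fun h => absurd ((s i).injective h) (by decide)
    rw [isPivot_genIdx_iff] at hnp
    rcases perm_cases_pivot (σ := σ) (pivotPos i') with
      ⟨h0, h1, -⟩ | ⟨h0, h1, -⟩ | ⟨-, -, h⟩
    · have hiff : (letter i (s i) 0 = letter i' σ 0 ∧ letter i (s i) 1 = letter i' σ 1) ↔
          i' = i ∧ σ = s i := by
        constructor
        · rintro ⟨g0, g1⟩
          refine letter_inj fun t => ?_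
          fin_cases t
          exacts [g0.symm, g1.symm, h2]
        · rintro ⟨rfl, rfl⟩
          exact ⟨rfl, rfl⟩
      have := hD2 i (letter i' σ 0) (letter i' σ 1) (e.symm a)
        (by rwa [isPivot_genIdx_iff]) (by rwa [isPivot_genIdx_iff])
      simp only [hiff] at this
      simp only [gen, LinearMap.comp_apply, AlgEquiv.toLinearMap_apply, map_mul,
        AlgEquiv.symm_apply_apply, this]
      split_ifs <;> simp
    · have := hD1 i (letter i' σ 1) (e.symm a * Xbar k n c (letter i' σ 0))
        (by rwa [isPivot_genIdx_iff])
      rw [if_neg]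
      · simp [gen, this]
      · rintro ⟨rfl, rfl⟩
        exact h0 (hs _)
    · exact absurd h hnp

theorem smul_sub_tensorProduct {M : Type*} [AddCommGroup M] [Module k M] (r : k) (x y : A ⊗[k] M) :
    r • (x - y) = r • x - r • y :=
  smul_sub r x y

variable (M : Type u) [AddCommGroup M] [Module k M]

/-- Right multiplication by a generator on the left factor of `A ⊗ M`. -/
def rightMul (j : Fin n) : A ⊗[k] M →ₗ[A] A ⊗[k] M :=
  AlgebraTensorModule.rTensor k M
    (LinearMap.toSpanSingleton A A (gen e j))

variable {M}

@[simp] theorem rightMul_tmul (j : Fin n) (a : A) (m : M) :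
    rightMul e M j (a ⊗ₜ[k] m) = (a * gen e j) ⊗ₜ m := rfl

variable (M) [Module A M] [IsScalarTower k A M]

/-- The action of a generator on the right factor of `A ⊗ M`. -/
def leftAct (j : Fin n) : A ⊗[k] M →ₗ[A] A ⊗[k] M :=
  AlgebraTensorModule.lTensor A A
    (Algebra.lsmul k k M (gen e j))

variable {M}

@[simp] theorem leftAct_tmul (j : Fin n) (a : A) (m : M) :
    leftAct e M j (a ⊗ₜ[k] m) = a ⊗ₜ (gen e j • m) := rfl

variable (M)

/-- The action map `A ⊗ M → M`. -/
def resolutionAug : A ⊗[k] M →ₗ[A] M :=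
  AlgebraTensorModule.lift
    { toFun := fun a => Algebra.lsmul k k M a
      map_add' := fun a b => by simp
      map_smul' := fun a b => by ext; simp }

/-- The differential `(A ⊗ M)ⁿ → A ⊗ M`. -/
def resolutionOne :
    (Fin n → A ⊗[k] M) →ₗ[A] A ⊗[k] M :=
  ∑ j, (rightMul e M j - leftAct e M j).comp (LinearMap.proj j)

/-- The differential `(A ⊗ M)ⁿ⁻² → (A ⊗ M)ⁿ`, given by the Fox derivatives of the relations. -/
def resolutionTwo : (Fin (n - 2) → A ⊗[k] M) →ₗ[A]
    (Fin n → A ⊗[k] M) :=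
  ∑ i, ∑ σ : Equiv.Perm (Fin 3), c σ •
    ((LinearMap.single _ _ (letter i σ 0)).comp
        ((leftAct e M (letter i σ 1)).comp (leftAct e M (letter i σ 2))) +
      (LinearMap.single _ _ (letter i σ 1)).comp
        ((leftAct e M (letter i σ 2)).comp (rightMul e M (letter i σ 0))) +
      (LinearMap.single _ _ (letter i σ 2)).comp
        ((rightMul e M (letter i σ 1)).comp (rightMul e M (letter i σ 0)))).comp
    (LinearMap.proj i)

variable {M}

@[simp] theorem resolutionAug_tmul (a : A) (m : M) :
    resolutionAug (k := k) (A := A) M (a ⊗ₜ[k] m) = a • m := rfl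

theorem resolutionOne_single (j : Fin n) (a : A) (m : M) :
    resolutionOne e M (Pi.single j (a ⊗ₜ[k] m)) =
      (a * gen e j) ⊗ₜ m - a ⊗ₜ (gen e j • m) := by
  rw [resolutionOne, LinearMap.sum_apply, Finset.sum_eq_single j]
  · simp
  · intro j' _ hj'
    simp [hj']
  · simp

theorem resolutionTwo_apply (ξ : Fin (n - 2) → A ⊗[k] M) :
    resolutionTwo e M ξ = ∑ i, ∑ σ : Equiv.Perm (Fin 3), c σ •
      (Pi.single (letter i σ 0) (leftAct e M (letter i σ 1) (leftAct e M (letter i σ 2) (ξ i))) +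
        Pi.single (letter i σ 1) (leftAct e M (letter i σ 2) (rightMul e M (letter i σ 0) (ξ i))) +
        Pi.single (letter i σ 2)
          (rightMul e M (letter i σ 1) (rightMul e M (letter i σ 0) (ξ i)))) := by
  simp [resolutionTwo]

theorem resolutionTwo_single (i : Fin (n - 2)) (a : A) (m : M) :
    resolutionTwo e M (Pi.single i (a ⊗ₜ[k] m)) = ∑ σ : Equiv.Perm (Fin 3), c σ •
      (Pi.single (letter i σ 0)
          (a ⊗ₜ[k] (gen e (letter i σ 1) • gen e (letter i σ 2) • m)) +
        Pi.single (letter i σ 1)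
          ((a * gen e (letter i σ 0)) ⊗ₜ[k] (gen e (letter i σ 2) • m)) +
        Pi.single (letter i σ 2)
          ((a * gen e (letter i σ 0) * gen e (letter i σ 1)) ⊗ₜ[k] m)) := by
  rw [resolutionTwo_apply, Finset.sum_eq_single i]
  · simp
  · intro i' _ hi'
    simp [hi']
  · simp

theorem gen_relation_smul (i : Fin (n - 2)) (m : M) :
    ∑ σ : Equiv.Perm (Fin 3), c σ • (gen e (letter i σ 0) • gen e (letter i σ 1) •
      gen e (letter i σ 2) • m) = 0 := by
  have h := congrArg (· • m) (gen_relation e i)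
  simpa only [Finset.sum_smul, smul_assoc, mul_smul, zero_smul] using h

theorem surjective_resolutionAug :
    Function.Surjective (resolutionAug (k := k) (A := A) M) :=
  fun m => ⟨1 ⊗ₜ m, by simp⟩

theorem tmul_sub_one_tmul_mem_range (a : A) (m : M) :
    a ⊗ₜ[k] m - 1 ⊗ₜ (a • m) ∈ LinearMap.range (resolutionOne e M) := by
  let P : Submodule k A :=
    { carrier := {a | ∀ m : M, a ⊗ₜ[k] m - 1 ⊗ₜ (a • m) ∈
        LinearMap.range (resolutionOne e M)}
      add_mem' := fun {a b} ha hb m => by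
        have := add_mem (ha m) (hb m)
        convert this using 1
        rw [add_smul, tmul_add, add_tmul]
        abel
      zero_mem' := fun m => by simp
      smul_mem' := fun r a ha m => by
        have := Submodule.smul_of_tower_mem _ r (ha m)
        convert this using 1
        rw [smul_sub, smul_assoc, tmul_smul]
        rfl }
  have hP : P = ⊤ := submodule_eq_top_of_mul_gen_mem e P (fun m => by simp) (fun a ha j m => by
    have := add_mem (LinearMap.mem_range_self (resolutionOne e M) (Pi.single j (a ⊗ₜ[k] m)))
      (ha (gen e j • m))
    rw [resolutionOne_single] at this
    convert this using 1
    rw [mul_smul]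
    abel)
  have ha : a ∈ P := by
    rw [hP]
    trivial
  exact ha m

theorem range_resolutionOne : LinearMap.range (resolutionOne e M) =
    LinearMap.ker (resolutionAug (k := k) (A := A) M) := by
  refine le_antisymm ?_ fun ξ hξ => ?_
  · rw [LinearMap.range_le_ker_iff]
    refine LinearMap.pi_ext' fun j => ?_
    refine AlgebraTensorModule.ext fun a m => ?_
    simp [resolutionOne_single, mul_smul]
  · have h : ∀ ξ : A ⊗[k] M, ξ - 1 ⊗ₜ (resolutionAug (k := k) (A := A) M ξ) ∈
        LinearMap.range (resolutionOne e M) := by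
      intro ξ
      induction ξ with
      | zero => simp
      | tmul a m => exact tmul_sub_one_tmul_mem_range e a m
      | add x y hx hy =>
        have := add_mem hx hy
        convert this using 1
        rw [map_add, tmul_add]
        abel
    have := h ξ
    rwa [LinearMap.mem_ker.1 hξ, tmul_zero, sub_zero] at this

theorem range_resolutionTwo : LinearMap.range (resolutionTwo e M) =
    LinearMap.ker (resolutionOne e M) := by
  refine le_antisymm ?_ fun ξ hξ => ?_
  · rw [LinearMap.range_le_ker_iff]
    refine LinearMap.pi_ext' fun i => ?_
    refine AlgebraTensorModule.ext fun a m => ?_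
    simp only [LinearMap.comp_apply, LinearMap.single_apply, LinearMap.zero_apply,
      resolutionTwo_single, map_sum, LinearMap.map_smul_of_tower, map_add, resolutionOne_single]
    have h1 : ∑ σ : Equiv.Perm (Fin 3), c σ • (a * gen e (letter i σ 0) *
        gen e (letter i σ 1) * gen e (letter i σ 2)) ⊗ₜ[k] m = 0 := by
      have := congrArg (fun b => (a * b) ⊗ₜ[k] m) (gen_relation e i)
      simpa [Finset.mul_sum, sum_tmul, mul_assoc, ← smul_tmul'] using this
    have h2 : ∑ σ : Equiv.Perm (Fin 3), c σ • a ⊗ₜ[k] (gen e (letter i σ 0) •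
        gen e (letter i σ 1) • gen e (letter i σ 2) • m) = 0 := by
      have := congrArg (fun b => a ⊗ₜ[k] b) (gen_relation_smul e i m)
      simpa only [tmul_sum, tmul_smul, tmul_zero] using this
    rw [← sub_zero (0 : A ⊗[k] M)]
    nth_rewrite 1 [← h1]
    rw [← h2, ← Finset.sum_sub_distrib]
    refine Finset.sum_congr rfl fun σ _ => ?_
    refine Eq.trans ?_ (smul_sub_tensorProduct (c σ) _ _)
    congr 1
    abel
  · let π : (Fin n → A ⊗[k] M) →ₗ[k]
        (Fin n → A ⊗[k] M) ⧸ LinearMap.range (resolutionTwo e M) :=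
      (LinearMap.range (resolutionTwo e M)).mkQ.restrictScalars k
    have hπ : ∀ x, π x = 0 ↔ x ∈ LinearMap.range (resolutionTwo e M) := fun x =>
      Submodule.Quotient.mk_eq_zero _
    obtain ⟨δ, hδ1, hδ⟩ := exists_twisted_derivation_gen e
      (N := M →ₗ[k] (Fin n → A ⊗[k] M) ⧸ LinearMap.range (resolutionTwo e M))
      (fun j => LinearMap.lcomp k _ (Algebra.lsmul k k M (gen e j)))
      (fun j => (TensorProduct.mk k A M).compr₂
        (π.comp (LinearMap.single k (fun _ => A ⊗[k] M) j)))
      (by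
        intro i f
        ext m
        have := congrArg f (gen_relation_smul e i m)
        simpa using this)
      (by
        intro i a
        ext m
        have := (hπ _).2 (LinearMap.mem_range_self (resolutionTwo e M) (Pi.single i (a ⊗ₜ[k] m)))
        rw [resolutionTwo_single] at this
        simpa using this)
    have hs : (TensorProduct.lift δ).comp ((resolutionOne e M).restrictScalars k) = π := by
      refine LinearMap.pi_ext' fun j => ?_
      refine TensorProduct.ext' fun a m => ?_
      simp [resolutionOne_single, hδ]
    rw [← hπ, ← hs, LinearMap.comp_apply, LinearMap.restrictScalars_apply,
      LinearMap.mem_ker.1 hξ, map_zero]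

end Resolution

section Injectivity

open TensorProduct

variable {k : Type} [Field k] {n : ℕ} {c : Equiv.Perm (Fin 3) → k}
  {A : Type} [Ring A] [Algebra k A] (e : QuotAlg k n c ≃ₐ[k] A)
  (M : Type u) [AddCommGroup M] [Module k M]

/-- The subspace `G ⊗ M` of `A ⊗ M`. -/
def tensorLeft (G : Submodule k A) : Submodule k (A ⊗[k] M) :=
  Submodule.map₂ (TensorProduct.mk k A M) G ⊤

variable {M}

theorem tensorLeft_induction {G : Submodule k A} {N : Type*} [AddCommGroup N] [Module k N]
    (f : A ⊗[k] M →ₗ[k] N) (P : Submodule k N)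
    (h : ∀ a ∈ G, ∀ m : M, f (a ⊗ₜ m) ∈ P) {x : A ⊗[k] M} (hx : x ∈ tensorLeft M G) :
    f x ∈ P := by
  have hle : tensorLeft M G ≤ P.comap f := Submodule.map₂_le.2 fun a ha m _ => h a ha m
  exact hle hx

theorem tmul_mem_tensorLeft {G : Submodule k A} {a : A} (ha : a ∈ G) (m : M) :
    a ⊗ₜ[k] m ∈ tensorLeft M G :=
  Submodule.apply_mem_map₂ (TensorProduct.mk k A M) ha (Submodule.mem_top (x := m))

theorem tensorLeft_mono {G H : Submodule k A} (h : G ≤ H) : tensorLeft M G ≤ tensorLeft M H :=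
  Submodule.map₂_le_map₂_left h

theorem exists_mem_tensorLeft {G : ℕ → Submodule k A} (hmono : Monotone G)
    (hex : ∀ a, ∃ m, a ∈ G m) (x : A ⊗[k] M) : ∃ m, x ∈ tensorLeft M (G m) := by
  induction x with
  | zero => exact ⟨0, zero_mem _⟩
  | tmul a m =>
    obtain ⟨p, hp⟩ := hex a
    exact ⟨p, tmul_mem_tensorLeft hp m⟩
  | add x y hx hy =>
    obtain ⟨p, hp⟩ := hx
    obtain ⟨q, hq⟩ := hy
    exact ⟨max p q, add_mem (tensorLeft_mono (hmono (le_max_left p q)) hp)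
      (tensorLeft_mono (hmono (le_max_right p q)) hq)⟩

variable [Module A M] [IsScalarTower k A M]

theorem injective_resolutionTwo (s : Fin (n - 2) → Equiv.Perm (Fin 3))
    (hs : ∀ i, s i 0 = pivotPos i) (hc : ∀ i, c (s i) ≠ 0) :
    Function.Injective (resolutionTwo e M) := by
  obtain ⟨G, D, hG0, hmono, hex, hD1, hD2, hD3⟩ := exists_extraction_gen e s hs hc
  rw [injective_iff_map_eq_zero]
  intro ξ hξ
  have step : ∀ m, (∀ i, ξ i ∈ tensorLeft M (G (m + 1))) → ∀ i, ξ i ∈ tensorLeft M (G m) := by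
    intro m hm i
    let E : A ⊗[k] M →ₗ[k] A ⊗[k] M := (D i).rTensor M
    have hE : ∀ a (x : M), E (a ⊗ₜ x) = D i a ⊗ₜ x := fun _ _ => rfl
    let Lk : Fin n → A ⊗[k] M →ₗ[k] A ⊗[k] M := fun j => (leftAct e M j).restrictScalars k
    let Rk : Fin n → A ⊗[k] M →ₗ[k] A ⊗[k] M := fun j => (rightMul e M j).restrictScalars k
    have t1 : ∀ i' v w, E (leftAct e M v (leftAct e M w (ξ i'))) ∈ tensorLeft M (G m) := by
      intro i' v w
      exact tensorLeft_induction (E.comp ((Lk v).comp (Lk w))) _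
        (fun a ha x => tmul_mem_tensorLeft (hD1 i m a ha) _) (hm i')
    have t2 : ∀ i' w u, E (leftAct e M w (rightMul e M u (ξ i'))) ∈ tensorLeft M (G m) := by
      intro i' w u
      exact tensorLeft_induction (E.comp ((Lk w).comp (Rk u))) _
        (fun a ha x => tmul_mem_tensorLeft (hD2 i m u a ha) _) (hm i')
    have t3 : ∀ i' σ, letter i' σ 2 = letter i (s i) 2 → ∀ x : A ⊗[k] M,
        E (rightMul e M (letter i' σ 1) (rightMul e M (letter i' σ 0) x)) =
          if i' = i ∧ σ = s i then x else 0 := by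
      intro i' σ h x
      induction x with
      | zero => simp
      | tmul a x =>
        rw [rightMul_tmul, rightMul_tmul, hE, hD3 i i' σ a h]
        split_ifs <;> simp
      | add x y hx hy =>
        rw [map_add, map_add, map_add, hx, hy]
        split_ifs <;> simp
    have key := congrArg E (congrFun hξ (letter i (s i) 2))
    rw [resolutionTwo_apply] at key
    simp only [Finset.sum_apply, Pi.smul_apply, Pi.add_apply, Pi.zero_apply, map_zero,
      map_sum, map_smul, map_add] at key
    have lead : ∑ i', ∑ σ : Equiv.Perm (Fin 3),
        c σ • (if i' = i ∧ σ = s i then ξ i' else 0) = c (s i) • ξ i := by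
      rw [Finset.sum_eq_single i, Finset.sum_eq_single (s i)]
      · simp
      · intro σ _ hσ
        simp [hσ]
      · simp
      · intro i' _ hi'
        simp [hi']
      · simp
    have hsub : ∀ (r : k) (x y : A ⊗[k] M), x - y ∈ tensorLeft M (G m) →
        r • x - r • y ∈ tensorLeft M (G m) := fun r x y h => by
      rw [← smul_sub_tensorProduct]
      exact Submodule.smul_mem _ r h
    have hmem : c (s i) • ξ i ∈ tensorLeft M (G m) := by
      rw [← neg_mem_iff, ← zero_sub, ← key, ← lead, ← Finset.sum_sub_distrib]
      refine Submodule.sum_mem _ fun i' _ => ?_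
      rw [← Finset.sum_sub_distrib]
      refine Submodule.sum_mem _ fun σ _ => ?_
      refine hsub (c σ) _ _ ?_
      rw [add_sub_assoc]
      refine add_mem (add_mem ?_ ?_) ?_
      · rw [Pi.single_apply]
        split_ifs
        exacts [t1 _ _ _, by simp]
      · rw [Pi.single_apply]
        split_ifs
        exacts [t2 _ _ _, by simp]
      · by_cases h : letter i' σ 2 = letter i (s i) 2
        · rw [← h, Pi.single_eq_same, t3 i' σ h, sub_self]
          exact zero_mem _
        · rw [Pi.single_eq_of_ne (Ne.symm h), map_zero, if_neg, sub_zero]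
          · exact zero_mem _
          · rintro ⟨rfl, rfl⟩
            exact h rfl
    exact (Submodule.smul_mem_iff _ (hc i)).1 hmem
  have descend : ∀ m, (∀ i, ξ i ∈ tensorLeft M (G m)) → ∀ i, ξ i ∈ tensorLeft M (G 0) := by
    intro m
    induction m with
    | zero => exact id
    | succ m ih => exact fun h => ih (step m h)
  choose p hp using fun i => exists_mem_tensorLeft hmono hex (ξ i)
  have h0 := descend (Finset.univ.sup p) fun i =>
    tensorLeft_mono (hmono (Finset.le_sup (Finset.mem_univ i))) (hp i)
  ext i
  simpa [hG0, tensorLeft] using h0 i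

theorem hasProjDimLE2_of_leading (e : QuotAlg k n c ≃ₐ[k] A) (s : Fin (n - 2) → Equiv.Perm (Fin 3))
    (hs : ∀ i, s i 0 = pivotPos i) (hc : ∀ i, c (s i) ≠ 0) : HasProjDimLE2 A M :=
  ⟨ModuleCat.of A (Fin (n - 2) → A ⊗[k] M), ModuleCat.of A (Fin n → A ⊗[k] M),
    ModuleCat.of A (A ⊗[k] M),
    inferInstanceAs (Module.Projective A (Fin (n - 2) → A ⊗[k] M)),
    inferInstanceAs (Module.Projective A (Fin n → A ⊗[k] M)),
    inferInstanceAs (Module.Projective A (A ⊗[k] M)),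
    resolutionTwo e M, resolutionOne e M, resolutionAug (k := k) M,
    injective_resolutionTwo e s hs hc, range_resolutionTwo e, range_resolutionOne e,
    surjective_resolutionAug⟩

end Injectivity

section LowerBound

open TensorProduct

/-- If a module has projective dimension at most one, then the kernel of any surjection onto it
from a projective module is projective. -/
theorem HasProjDimLE1.projective_ker {A : Type} [Ring A] {M : Type u} [AddCommGroup M]
    [Module A M] (h : HasProjDimLE1 A M) {P : Type u} [AddCommGroup P] [Module A P]
    [Module.Projective A P] {f : P →ₗ[A] M} (hf : Function.Surjective f) :
    Module.Projective A (LinearMap.ker f) := by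
  obtain ⟨Q₁, Q₀, _, _, g₁, g₀, hg₁, hex, hg₀⟩ := h
  obtain ⟨φ, hφ⟩ := Module.projective_lifting_property g₀ f hg₀
  obtain ⟨ψ, hψ⟩ := Module.projective_lifting_property f g₀ hf
  have hφ' : ∀ x, g₀ (φ x) = f x := fun x => LinearMap.congr_fun hφ x
  have hψ' : ∀ x, f (ψ x) = g₀ x := fun x => LinearMap.congr_fun hψ x
  let eq : Q₁ ≃ₗ[A] LinearMap.range g₁ := LinearEquiv.ofInjective g₁ hg₁
  have heq : ∀ y, g₁ (eq.symm y) = y := fun y =>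
    congrArg Subtype.val (eq.apply_symm_apply y)
  have hzero : ∀ q, g₀ (g₁ q) = 0 := fun q => by
    rw [← LinearMap.mem_ker, ← hex]
    exact LinearMap.mem_range_self g₁ q
  let i : LinearMap.ker f →ₗ[A] P × Q₁ :=
    (LinearMap.ker f).subtype.prod (eq.symm.toLinearMap.comp
      ((φ.comp (LinearMap.ker f).subtype).codRestrict (LinearMap.range g₁) fun x => by
        rw [hex, LinearMap.mem_ker, LinearMap.comp_apply, hφ']
        exact x.2))
  let r : P × Q₁ →ₗ[A] LinearMap.ker f :=
    ((LinearMap.id - ψ.comp φ).coprod (ψ.comp g₁)).codRestrict (LinearMap.ker f) fun x => by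
      simp [hψ', hφ', hzero]
  refine Module.Projective.of_split i r ?_
  refine LinearMap.ext fun x => Subtype.ext ?_
  change (x.1 - ψ (φ x.1)) + ψ (g₁ (eq.symm _)) = x.1
  rw [heq]
  exact sub_add_cancel _ _

/-- The second differential of a length-two resolution splits if the resolved module has
projective dimension at most one. -/
theorem HasProjDimLE1.exists_retraction {A : Type} [Ring A] {M : Type u} [AddCommGroup M]
    [Module A M] (h : HasProjDimLE1 A M) {P₂ P₁ P₀ : Type u} [AddCommGroup P₂] [Module A P₂]
    [AddCommGroup P₁] [Module A P₁] [AddCommGroup P₀] [Module A P₀] [Module.Projective A P₀]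
    {f₂ : P₂ →ₗ[A] P₁} {f₁ : P₁ →ₗ[A] P₀} {f₀ : P₀ →ₗ[A] M} (hf₂ : Function.Injective f₂)
    (h₁ : LinearMap.range f₂ = LinearMap.ker f₁) (h₀ : LinearMap.range f₁ = LinearMap.ker f₀)
    (hf₀ : Function.Surjective f₀) : ∃ ρ : P₁ →ₗ[A] P₂, ∀ x, ρ (f₂ x) = x := by
  have hproj := h.projective_ker hf₀
  rw [← h₀] at hproj
  obtain ⟨t, ht⟩ := Module.projective_lifting_property f₁.rangeRestrict LinearMap.id
    f₁.surjective_rangeRestrict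
  have ht' : ∀ y, f₁ (t y) = y := fun y => congrArg Subtype.val (LinearMap.congr_fun ht y)
  let eq : P₂ ≃ₗ[A] LinearMap.range f₂ := LinearEquiv.ofInjective f₂ hf₂
  have heq : ∀ y, f₂ (eq.symm y) = y := fun y => congrArg Subtype.val (eq.apply_symm_apply y)
  refine ⟨eq.symm.toLinearMap.comp
    ((LinearMap.id - t.comp f₁.rangeRestrict).codRestrict (LinearMap.range f₂) fun x => by
      rw [h₁, LinearMap.mem_ker]
      simp [ht']), fun x => hf₂ ?_⟩
  have hx : f₁.rangeRestrict (f₂ x) = 0 := by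
    refine Subtype.ext ?_
    rw [LinearMap.codRestrict_apply, ZeroMemClass.coe_zero, ← LinearMap.mem_ker, ← h₁]
    exact LinearMap.mem_range_self f₂ x
  simp [heq, hx]

variable {k : Type} [Field k] {n : ℕ} {c : Equiv.Perm (Fin 3) → k}
  {A : Type} [Ring A] [Algebra k A] (e : QuotAlg k n c ≃ₐ[k] A)
  {M : Type u} [AddCommGroup M] [Module k M] [Module A M] [IsScalarTower k A M]

theorem not_hasProjDimLE1_of_gen_smul_eq_zero (hn : 3 ≤ n)
    (s : Fin (n - 2) → Equiv.Perm (Fin 3)) (hs : ∀ i, s i 0 = pivotPos i)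
    (hc : ∀ i, c (s i) ≠ 0) (hM : ∀ j (m : M), gen e j • m = 0) [Nontrivial M] :
    ¬ HasProjDimLE1 A M := by
  intro h
  obtain ⟨ρ, hρ⟩ := h.exists_retraction (injective_resolutionTwo e (M := M) s hs hc)
    (range_resolutionTwo e) (range_resolutionOne e) surjective_resolutionAug
  obtain ⟨m, hm⟩ := exists_ne (0 : M)
  let i : Fin (n - 2) := ⟨0, by omega⟩
  have key := congrArg (fun ξ => resolutionAug (k := k) M (ξ i)) (hρ (Pi.single i (1 ⊗ₜ m)))
  have hfac : ∀ u v w, (Pi.single w ((1 * gen e u * gen e v) ⊗ₜ[k] m) : Fin n → A ⊗[k] M) =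
      gen e u • Pi.single w (gen e v ⊗ₜ[k] m) := by
    intro u v w
    rw [← Pi.single_smul, one_mul, smul_tmul', smul_eq_mul]
  refine hm ?_
  simp only [Pi.single_eq_same, resolutionAug_tmul, one_smul] at key
  rw [← key, resolutionTwo_single]
  simp only [hM, smul_zero, tmul_zero, Pi.single_zero, zero_add, hfac, map_sum,
    LinearMap.map_smul_of_tower, map_smul, Finset.sum_apply, Pi.smul_apply,
    Finset.sum_const_zero]

end LowerBound

/-- under the coefficient condition, the algebra
`A = k⟨x_1,…,x_n⟩/(r_1,…,r_{n-2})` has global dimension 2: every left `A`-module has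
projective dimension at most 2, and some `A`-module has projective dimension exactly 2. -/
theorem global_dimension_two
    (k : Type) [Field k] (n : ℕ) (hn : 3 ≤ n)
    (c : Equiv.Perm (Fin 3) → k)
    (hc : ∀ a : Fin 3, ∃ σ : Equiv.Perm (Fin 3), σ 0 = a ∧ c σ ≠ 0) :
    (∀ (M : Type u) [AddCommGroup M] [Module (QuotAlg k n c) M],
        HasProjDimLE2 (QuotAlg k n c) M) ∧
    (∃ M : ModuleCat.{u} (QuotAlg k n c),
        HasProjDimLE2 (QuotAlg k n c) M ∧ ¬ HasProjDimLE1 (QuotAlg k n c) M) := by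
  choose s hs hcs using fun i : Fin (n - 2) => hc (pivotPos i)
  constructor
  · intro M _ _
    let : Module k M := Module.compHom M (algebraMap k (QuotAlg k n c))
    have : IsScalarTower k (QuotAlg k n c) M :=
      ⟨fun r a m => by rw [Algebra.smul_def, mul_smul]; rfl⟩
    exact hasProjDimLE2_of_leading (k := k) AlgEquiv.refl s hs hcs
  · let : Module (QuotAlg k n c) (ULift.{u} k) :=
      Module.compHom (ULift.{u} k) (aug k n c).toRingHom
    have hsmul : ∀ (a : QuotAlg k n c) (m : ULift.{u} k), a • m = aug k n c a • m :=
      fun _ _ => rfl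
    have : IsScalarTower k (QuotAlg k n c) (ULift.{u} k) :=
      ⟨fun r a m => by rw [hsmul, hsmul, map_smul, smul_assoc]⟩
    refine ⟨ModuleCat.of _ (ULift.{u} k),
      hasProjDimLE2_of_leading (k := k) (M := ULift.{u} k) AlgEquiv.refl s hs hcs,
      not_hasProjDimLE1_of_gen_smul_eq_zero (k := k) (M := ULift.{u} k) AlgEquiv.refl hn s hs hcs
        fun j m => ?_⟩
    have hj : aug k n c (Xbar k n c j) = 0 := by
      rw [aug, Xbar, RingQuot.liftAlgHom_mkAlgHom_apply, FreeAlgebra.lift_ι_apply]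
    change aug k n c (Xbar k n c j) • m = 0
    rw [hj, zero_smul]

end
end

section
/- Let k be a field, n ≥ 3 an integer, and c : S₃ → k a function such that for every a ∈ {1,2,3} there exists a permutation σ with σ(1) = a and c(σ) ≠ 0. Let A be the quotient of the free associative unital k-algebra on x₁,…,xₙ by the two-sided ideal generated by r_i = Σ_{σ∈S₃} c(σ)·x_{i−1+σ(1)} x_{i−1+σ(2)} x_{i−1+σ(3)}, i = 1,…,n−2. Then the one-dimensional trivial A-module k (defined via the augmentation homomorphism ε : A → k sending the class of each generator x_j to 0) has projective dimension exactly 2. -/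
open scoped BigOperators

noncomputable section

universe u

namespace FreeAlgebra

section Words

variable {k X I : Type} [Field k]

/-- The noncommutative monomial attached to a word. -/
def word (k : Type) [Field k] {X : Type} (w : List X) : FreeAlgebra k X :=
  (w.map (ι k)).prod

@[simp] lemma word_nil : word k ([] : List X) = 1 := by simp [word]

@[simp] lemma word_append (u v : List X) : word k (u ++ v) = word k u * word k v := by
  simp [word]

lemma word_cons (x : X) (v : List X) : word k (x :: v) = ι k x * word k v := by
  simp [word]

/-- The monomial basis of the free algebra, indexed by words. -/
def wordBasis (k X : Type) [Field k] : Module.Basis (List X) k (FreeAlgebra k X) :=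
  (basisFreeMonoid k X).reindex FreeMonoid.toList

@[simp] lemma wordBasis_apply (w : List X) : wordBasis k X w = word k w := by
  simp only [wordBasis, Module.Basis.reindex_apply, basisFreeMonoid, Module.Basis.map_apply]
  simp only [LinearEquiv.trans_symm, Finsupp.coe_basisSingleOne, LinearEquiv.trans_apply]
  change equivMonoidAlgebraFreeMonoid.symm (MonoidAlgebra.single _ 1) = _
  rw [AlgEquiv.symm_apply_eq]
  induction w with
  | nil => simp [MonoidAlgebra.one_def]
  | cons x w ih =>
    rw [word_cons, map_mul, ← ih]
    simp only [equivMonoidAlgebraFreeMonoid, AlgEquiv.ofAlgHom_apply, lift_ι_apply]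
    change _ = MonoidAlgebra.single (FreeMonoid.of x) 1 * _
    rw [MonoidAlgebra.single_mul_single, one_mul]
    rfl

/-- Two linear maps on the free algebra agreeing on words are equal. -/
lemma hom_ext_word {M : Type*} [AddCommGroup M] [Module k M] {f g : FreeAlgebra k X →ₗ[k] M}
    (h : ∀ w, f (word k w) = g (word k w)) : f = g :=
  (wordBasis k X).ext fun w => by simpa using h w

lemma span_word : Submodule.span k (Set.range (word k (X := X))) = ⊤ := by
  rw [← (wordBasis k X).span_eq]
  congr 2
  ext w
  simp

/-- The linear map with prescribed values on words. -/
def wordLift (M : Type*) [AddCommGroup M] [Module k M] (f : List X → M) :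
    FreeAlgebra k X →ₗ[k] M :=
  (wordBasis k X).constr k f

@[simp] lemma wordLift_word {M : Type*} [AddCommGroup M] [Module k M] (f : List X → M)
    (w : List X) : wordLift M f (word k w) = f w := by
  rw [← wordBasis_apply, wordLift, Module.Basis.constr_basis]

end Words

section RightDerivative

variable {k X : Type} [Field k]

open Classical in
/-- The linear map deleting a final letter `j`, and killing the words not ending in `j`. -/
def rightDeriv (k : Type) [Field k] {X : Type} (j : X) : FreeAlgebra k X →ₗ[k] FreeAlgebra k X :=
  wordLift _ fun w => if w.getLast? = some j then word k w.dropLast else 0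

@[simp] lemma rightDeriv_one (j : X) : rightDeriv k j (1 : FreeAlgebra k X) = 0 := by
  rw [← word_nil, rightDeriv, wordLift_word]
  simp

lemma rightDeriv_mul_ι [DecidableEq X] (j l : X) (f : FreeAlgebra k X) :
    rightDeriv k j (f * ι k l) = if l = j then f else 0 := by
  have : rightDeriv k j ∘ₗ LinearMap.mulRight k (ι k l) =
      if l = j then LinearMap.id else 0 := by
    refine hom_ext_word fun w => ?_
    have h : word k w * ι k l = word k (w ++ [l]) := by simp [word]
    simp only [LinearMap.comp_apply, LinearMap.mulRight_apply, h]
    rw [rightDeriv, wordLift_word]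
    split_ifs <;> simp_all
  have := LinearMap.congr_fun this f
  simp only [LinearMap.comp_apply, LinearMap.mulRight_apply] at this
  rw [this]
  split_ifs <;> rfl

lemma rightDeriv_sum [Fintype X] (j : X) (g : X → FreeAlgebra k X) :
    rightDeriv k j (∑ l, g l * ι k l) = g j := by
  classical
  simp [rightDeriv_mul_ι]

lemma eq_sum_rightDeriv [Fintype X] (f : FreeAlgebra k X) :
    f = algebraMap k _ (lift k (fun _ : X => (0 : k)) f) + ∑ j, rightDeriv k j f * ι k j := by
  classical
  have : (LinearMap.id : FreeAlgebra k X →ₗ[k] FreeAlgebra k X) =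
      (Algebra.linearMap k _) ∘ₗ (lift k (fun _ : X => (0 : k))).toLinearMap +
        ∑ j, LinearMap.mulRight k (ι k j) ∘ₗ rightDeriv k j := by
    refine hom_ext_word fun w => ?_
    rcases List.eq_nil_or_concat w with rfl | ⟨v, l, rfl⟩
    · simp
    · have h : word k (v ++ [l]) = word k v * ι k l := by simp [word]
      simp [List.concat_eq_append, h, rightDeriv_mul_ι]
  simpa using LinearMap.congr_fun this f

lemma rightDeriv_mul [Fintype X] (j : X) (f g : FreeAlgebra k X)
    (hg : lift k (fun _ : X => (0 : k)) g = 0) :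
    rightDeriv k j (f * g) = f * rightDeriv k j g := by
  conv_lhs => rw [eq_sum_rightDeriv g, hg]
  simp only [map_zero, zero_add, Finset.mul_sum, ← mul_assoc, rightDeriv_sum]

end RightDerivative

end FreeAlgebra

/-- A family of elements of the free algebra, each with a leading word, such that leading words
do not overlap: every word has at most one factorization whose first leading factor is preceded
by a word without leading factors. Being leading is measured by a weight on words. -/
structure NonoverlappingFamily (k X I : Type) [Field k] where
  /-- The leading words. -/
  lead : I → List X
  /-- The elements of the family. -/
  elt : I → FreeAlgebra k X
  /-- The weight with respect to which words are compared. -/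
  weight : List X → ℕ
  lead_ne_nil : ∀ i, lead i ≠ []
  elt_sub_lead_mem : ∀ i, elt i - FreeAlgebra.word k (lead i) ∈ Submodule.span k
    (FreeAlgebra.word k '' {m | ∀ u v, weight (u ++ m ++ v) < weight (u ++ lead i ++ v)})
  unique_factorization : ∀ u u' v v' i i', (∀ a j b, u ≠ a ++ lead j ++ b) →
    (∀ a j b, u' ≠ a ++ lead j ++ b) → u ++ lead i ++ v = u' ++ lead i' ++ v' →
    u = u' ∧ i = i' ∧ v = v'

namespace NonoverlappingFamily

open FreeAlgebra

variable {k X I : Type} [Field k] (R : NonoverlappingFamily k X I)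

/-- A word is normal if it has no leading word as a factor. -/
def IsNormal (w : List X) : Prop := ∀ a j b, w ≠ a ++ R.lead j ++ b

lemma exists_factorization (w : List X) (hw : ¬ R.IsNormal w) :
    ∃ p : List X × I × List X, R.IsNormal p.1 ∧ w = p.1 ++ R.lead p.2.1 ++ p.2.2 := by
  induction hL : w.length using Nat.strong_induction_on generalizing w with
  | _ L ih =>
    have hw' := hw
    simp only [IsNormal, not_forall, not_not] at hw'
    obtain ⟨a, j, b, rfl⟩ := hw'
    by_cases ha : R.IsNormal a
    · exact ⟨(a, j, b), ha, rfl⟩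
    · have hlt : a.length < L := by
        have := List.length_pos_iff.2 (R.lead_ne_nil j)
        simp at hL
        omega
      obtain ⟨⟨a', j', b'⟩, hn, rfl⟩ := ih _ hlt a ha rfl
      exact ⟨(a', j', b' ++ R.lead j ++ b), hn, by simp⟩

open Classical in
/-- The linear endomorphism fixing normal words and replacing the first leading factor of any
other word by the corresponding element of the family. -/
def substitute : FreeAlgebra k X →ₗ[k] FreeAlgebra k X :=
  wordLift _ fun w => if hw : R.IsNormal w then word k w else
    word k (R.exists_factorization w hw).choose.1 *
      R.elt (R.exists_factorization w hw).choose.2.1 *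
      word k (R.exists_factorization w hw).choose.2.2

lemma substitute_normal {w : List X} (hw : R.IsNormal w) :
    R.substitute (word k w) = word k w := by
  simp [substitute, hw]

lemma substitute_factorization {u : List X} (hu : R.IsNormal u) (i : I) (v : List X) :
    R.substitute (word k (u ++ R.lead i ++ v)) = word k u * R.elt i * word k v := by
  have hw : ¬ R.IsNormal (u ++ R.lead i ++ v) := fun h => h u i v rfl
  have hs := (R.exists_factorization _ hw).choose_spec
  obtain ⟨h1, h2, h3⟩ := R.unique_factorization _ _ _ _ _ _ hu hs.1 hs.2
  rw [substitute, wordLift_word, dif_neg hw, ← h1, ← h2, ← h3]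

/-- The span of the words of weight less than `m`. -/
def weightLT (m : ℕ) : Submodule k (FreeAlgebra k X) :=
  Submodule.span k (word k '' {w | R.weight w < m})

lemma weightLT_mono {m m' : ℕ} (h : m ≤ m') : R.weightLT m ≤ R.weightLT m' :=
  Submodule.span_mono (Set.image_mono fun _ hw => lt_of_lt_of_le hw h)

lemma exists_mem_weightLT (f : FreeAlgebra k X) : ∃ m, f ∈ R.weightLT m := by
  have hf : f ∈ Submodule.span k (Set.range (word k (X := X))) := by
    rw [span_word]; trivial
  induction hf using Submodule.span_induction with
  | mem x hx =>
    obtain ⟨w, rfl⟩ := hx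
    exact ⟨R.weight w + 1, Submodule.subset_span ⟨w, Nat.lt_succ_self _, rfl⟩⟩
  | zero => exact ⟨0, zero_mem _⟩
  | add x y _ _ hx hy =>
    obtain ⟨a, ha⟩ := hx
    obtain ⟨b, hb⟩ := hy
    exact ⟨max a b, add_mem (R.weightLT_mono (le_max_left _ _) ha)
      (R.weightLT_mono (le_max_right _ _) hb)⟩
  | smul c x _ hx =>
    obtain ⟨a, ha⟩ := hx
    exact ⟨a, Submodule.smul_mem _ _ ha⟩

lemma substitute_word_sub_mem (w : List X) :
    R.substitute (word k w) - word k w ∈ R.weightLT (R.weight w) := by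
  by_cases hw : R.IsNormal w
  · simp [R.substitute_normal hw]
  · obtain ⟨⟨u, i, v⟩, hu, rfl⟩ := R.exists_factorization w hw
    rw [R.substitute_factorization hu, word_append, word_append, ← sub_mul, ← mul_sub]
    have key := Submodule.mem_map_of_mem
      (f := LinearMap.mulRight k (word k v) ∘ₗ LinearMap.mulLeft k (word k u))
      (R.elt_sub_lead_mem i)
    rw [Submodule.map_span] at key
    refine Submodule.span_mono ?_ key
    rintro _ ⟨_, ⟨m, hm, rfl⟩, rfl⟩
    exact ⟨u ++ m ++ v, hm u v, by simp [mul_assoc]⟩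

lemma substitute_sub_mem (m : ℕ) (f : FreeAlgebra k X) (hf : f ∈ R.weightLT (m + 1)) :
    R.substitute f - f ∈ R.weightLT m := by
  have : R.weightLT (m + 1) ≤ (R.weightLT m).comap (R.substitute - LinearMap.id) := by
    rw [weightLT, Submodule.span_le]
    rintro _ ⟨w, hw, rfl⟩
    exact R.weightLT_mono (Nat.lt_succ_iff.1 hw) (R.substitute_word_sub_mem w)
  exact this hf

lemma weightLT_zero : R.weightLT 0 = ⊥ := by
  simp [weightLT]

lemma substitute_injective : Function.Injective R.substitute := by
  rw [← LinearMap.ker_eq_bot, LinearMap.ker_eq_bot']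
  intro f hf
  obtain ⟨m, hm⟩ := R.exists_mem_weightLT f
  induction m with
  | zero => simpa [weightLT_zero] using hm
  | succ m ih =>
    refine ih ?_
    simpa [hf] using R.substitute_sub_mem m f hm

lemma substitute_surjective : Function.Surjective R.substitute := by
  have key : ∀ m, ∀ f ∈ R.weightLT m, f ∈ LinearMap.range R.substitute := by
    intro m
    induction m with
    | zero =>
      intro f hf
      rw [weightLT_zero, Submodule.mem_bot] at hf
      simp [hf]
    | succ m ih =>
      intro f hf
      have := sub_mem (LinearMap.mem_range_self R.substitute f)
        (ih _ (R.substitute_sub_mem m f hf))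
      simpa using this
  intro f
  obtain ⟨m, hm⟩ := R.exists_mem_weightLT f
  exact key m f hm

/-- The substitution of leading words by elements of the family is a linear automorphism. -/
def substituteEquiv : FreeAlgebra k X ≃ₗ[k] FreeAlgebra k X :=
  LinearEquiv.ofBijective R.substitute ⟨R.substitute_injective, R.substitute_surjective⟩

/-- The span of normal words. -/
def normalSpan : Submodule k (FreeAlgebra k X) :=
  Submodule.span k (word k '' {w | R.IsNormal w})

/-- The span of the products of a normal word, an element of the family and a word. -/
def idealSpan : Submodule k (FreeAlgebra k X) :=
  Submodule.span k {f | ∃ u i v, R.IsNormal u ∧ f = word k u * R.elt i * word k v}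

lemma normalSpan_sup_idealSpan : R.normalSpan ⊔ R.idealSpan = ⊤ := by
  rw [eq_top_iff, ← LinearMap.range_eq_top.2 R.substitute_surjective, LinearMap.range_eq_map,
    ← span_word, Submodule.map_span, Submodule.span_le]
  rintro _ ⟨_, ⟨w, rfl⟩, rfl⟩
  by_cases hw : R.IsNormal w
  · rw [R.substitute_normal hw]
    exact Submodule.mem_sup_left (Submodule.subset_span ⟨w, hw, rfl⟩)
  · obtain ⟨⟨u, i, v⟩, hu, rfl⟩ := R.exists_factorization w hw
    rw [R.substitute_factorization hu]
    exact Submodule.mem_sup_right (Submodule.subset_span ⟨u, i, v, hu, rfl⟩)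

lemma exists_normal_add_ideal (f : FreeAlgebra k X) :
    ∃ g ∈ R.normalSpan, ∃ h ∈ R.idealSpan, g + h = f :=
  Submodule.mem_sup.1 (by rw [normalSpan_sup_idealSpan]; trivial)

lemma idealSpan_mul_mem {f : FreeAlgebra k X} (hf : f ∈ R.idealSpan) (g : FreeAlgebra k X) :
    f * g ∈ R.idealSpan := by
  have hg : g ∈ Submodule.span k (Set.range (word k (X := X))) := by
    rw [span_word]; trivial
  have := Submodule.mul_mem_mul hf hg
  rw [idealSpan, Submodule.span_mul_span] at this
  refine Submodule.span_mono ?_ this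
  rintro _ ⟨_, ⟨u, i, v, hu, rfl⟩, _, ⟨w, rfl⟩, rfl⟩
  exact ⟨u, i, v ++ w, hu, by simp [mul_assoc]⟩

lemma mul_elt_mem (f : FreeAlgebra k X) (i : I) : f * R.elt i ∈ R.idealSpan := by
  obtain ⟨g, hg, h, hh, rfl⟩ := R.exists_normal_add_ideal f
  rw [add_mul]
  refine add_mem ?_ (R.idealSpan_mul_mem hh _)
  have key := Submodule.mem_map_of_mem (f := LinearMap.mulRight k (R.elt i)) hg
  rw [normalSpan, Submodule.map_span] at key
  refine Submodule.span_mono ?_ key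
  rintro _ ⟨_, ⟨u, hu, rfl⟩, rfl⟩
  exact ⟨u, i, [], hu, by simp⟩

lemma mul_idealSpan_mem (g : FreeAlgebra k X) {f : FreeAlgebra k X} (hf : f ∈ R.idealSpan) :
    g * f ∈ R.idealSpan := by
  have : R.idealSpan ≤ R.idealSpan.comap (LinearMap.mulLeft k g) := by
    conv_lhs => rw [idealSpan]
    rw [Submodule.span_le]
    rintro _ ⟨u, i, v, hu, rfl⟩
    simp only [Submodule.comap_coe, Set.mem_preimage, LinearMap.mulLeft_apply, SetLike.mem_coe,
      ← mul_assoc]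
    exact R.idealSpan_mul_mem (R.mul_elt_mem _ _) _
  exact this hf

lemma elt_mem (i : I) : R.elt i ∈ R.idealSpan := by
  simpa using R.mul_elt_mem 1 i

open Classical in
/-- The linear map sending a word of the form `u ++ lead i` with `u` normal to `u`, and other
words to zero. -/
def leadQuot (i : I) : FreeAlgebra k X →ₗ[k] FreeAlgebra k X :=
  wordLift _ fun w => if h : ∃ u, R.IsNormal u ∧ w = u ++ R.lead i then word k h.choose else 0

lemma leadQuot_factorization [DecidableEq I] {u : List X} (hu : R.IsNormal u) (i l : I)
    (v : List X) :
    R.leadQuot i (word k (u ++ R.lead l ++ v)) = if l = i ∧ v = [] then word k u else 0 := by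
  rw [leadQuot, wordLift_word]
  split_ifs with h h' h'
  · have hs := h.choose_spec
    obtain ⟨h1, -, -⟩ := R.unique_factorization u h.choose v [] l i hu hs.1
      (by simpa using hs.2)
    rw [← h1]
  · have hs := h.choose_spec
    obtain ⟨-, h2, h3⟩ := R.unique_factorization u h.choose v [] l i hu hs.1
      (by simpa using hs.2)
    exact absurd ⟨h2, h3⟩ h'
  · obtain ⟨rfl, rfl⟩ := h'
    exact absurd ⟨u, hu, by simp⟩ h
  · rfl

/-- The coefficient of `elt i` of an element of the ideal, modulo decomposables. -/
def coeff (i : I) : FreeAlgebra k X →ₗ[k] FreeAlgebra k X :=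
  R.leadQuot i ∘ₗ R.substituteEquiv.symm.toLinearMap

lemma coeff_word_mul [DecidableEq I] {u : List X} (hu : R.IsNormal u) (i l : I) (v : List X) :
    R.coeff i (word k u * R.elt l * word k v) = if l = i ∧ v = [] then word k u else 0 := by
  rw [← R.leadQuot_factorization hu, ← R.substitute_factorization hu]
  simp only [coeff, LinearMap.comp_apply]
  congr 1
  exact R.substituteEquiv.symm_apply_apply _

lemma coeff_idealSpan_mul_ι (i : I) {f : FreeAlgebra k X} (hf : f ∈ R.idealSpan) (x : X) :
    R.coeff i (f * ι k x) = 0 := by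
  classical
  have : R.idealSpan ≤ LinearMap.ker (R.coeff i ∘ₗ LinearMap.mulRight k (ι k x)) := by
    rw [idealSpan, Submodule.span_le]
    rintro _ ⟨u, l, v, hu, rfl⟩
    have h : word k u * R.elt l * word k v * ι k x =
        word k u * R.elt l * word k (v ++ [x]) := by simp [word, mul_assoc]
    simp [h, R.coeff_word_mul hu, -word_append]
  exact this hf

lemma coeff_normal_mul_elt [DecidableEq I] (i l : I) {f : FreeAlgebra k X}
    (hf : f ∈ R.normalSpan) : R.coeff i (f * R.elt l) = if l = i then f else 0 := by
  induction hf using Submodule.span_induction with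
  | mem x hx =>
    obtain ⟨w, hw, rfl⟩ := hx
    simpa using R.coeff_word_mul hw i l []
  | zero => simp
  | add x y _ _ hx hy => rw [add_mul, map_add, hx, hy]; split_ifs <;> simp
  | smul c x _ hx => rw [smul_mul_assoc, map_smul, hx]; split_ifs <;> simp

variable [Fintype X]

lemma elt_eq_sum (h0 : ∀ i, lift k (fun _ : X => (0 : k)) (R.elt i) = 0) (i : I) :
    R.elt i = ∑ j, rightDeriv k j (R.elt i) * ι k j := by
  conv_lhs => rw [eq_sum_rightDeriv (R.elt i), h0 i]
  simp

lemma coeff_mul_elt_sub_mem [DecidableEq I]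
    (h0 : ∀ i, lift k (fun _ : X => (0 : k)) (R.elt i) = 0) (i l : I) (f : FreeAlgebra k X) :
    R.coeff i (f * R.elt l) - (if l = i then f else 0) ∈ R.idealSpan := by
  obtain ⟨g, hg, h, hh, rfl⟩ := R.exists_normal_add_ideal f
  have hz : R.coeff i (h * R.elt l) = 0 := by
    rw [R.elt_eq_sum h0 l, Finset.mul_sum, map_sum]
    refine Finset.sum_eq_zero fun j _ => ?_
    rw [← mul_assoc]
    exact R.coeff_idealSpan_mul_ι i (R.idealSpan_mul_mem hh _) j
  rw [add_mul, map_add, hz, R.coeff_normal_mul_elt i l hg]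
  split_ifs
  · simpa using hh
  · simp

lemma mem_idealSpan_of_sum_mul_rightDeriv_mem [Fintype I]
    (h0 : ∀ i, lift k (fun _ : X => (0 : k)) (R.elt i) = 0) (b : I → FreeAlgebra k X)
    (hb : ∀ j, ∑ i, b i * rightDeriv k j (R.elt i) ∈ R.idealSpan) (i : I) :
    b i ∈ R.idealSpan := by
  classical
  have h1 : ∑ l, b l * R.elt l = ∑ j, (∑ l, b l * rightDeriv k j (R.elt l)) * ι k j := by
    simp only [Finset.sum_mul]
    rw [Finset.sum_comm]
    refine Finset.sum_congr rfl fun l _ => ?_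
    conv_lhs => rw [R.elt_eq_sum h0 l, Finset.mul_sum]
    simp only [mul_assoc]
  have h2 : R.coeff i (∑ l, b l * R.elt l) = 0 := by
    rw [h1, map_sum]
    exact Finset.sum_eq_zero fun j _ => R.coeff_idealSpan_mul_ι i (hb j) j
  have h3 : ∑ l, (R.coeff i (b l * R.elt l) - (if l = i then b l else 0)) ∈ R.idealSpan :=
    Submodule.sum_mem _ fun l _ => R.coeff_mul_elt_sub_mem h0 i l (b l)
  rw [Finset.sum_sub_distrib, ← map_sum, h2] at h3
  simpa using h3

end NonoverlappingFamily

section Resolution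

open FreeAlgebra

variable {k X I A : Type} [Field k] [Fintype I] [Ring A] [Algebra k A]

/-- The map `A^I → A^X` of the free resolution of the trivial module whose matrix consists of the
right derivatives of the relations. -/
def relationMap (π : FreeAlgebra k X →ₐ[k] A) (r : I → FreeAlgebra k X) :
    (I → A) →ₗ[A] (X → A) :=
  Fintype.linearCombination A fun i j => π (rightDeriv k j (r i))

lemma relationMap_apply (π : FreeAlgebra k X →ₐ[k] A) (r : I → FreeAlgebra k X) (b : I → A)
    (j : X) : relationMap π r b j = ∑ i, b i * π (rightDeriv k j (r i)) := by
  simp [relationMap, Fintype.linearCombination_apply]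

variable [Fintype X]

/-- The map `A^X → A` sending the basis to the generators. -/
def generatorMap (π : FreeAlgebra k X →ₐ[k] A) : (X → A) →ₗ[A] A :=
  Fintype.linearCombination A fun j => π (ι k j)

lemma generatorMap_apply (π : FreeAlgebra k X →ₐ[k] A) (a : X → A) :
    generatorMap π a = ∑ j, a j * π (ι k j) := by
  simp [generatorMap, Fintype.linearCombination_apply]

lemma range_generatorMap (π : FreeAlgebra k X →ₐ[k] A) (hπ : Function.Surjective π)
    (ε : A →ₐ[k] k) (hε : ∀ j, ε (π (ι k j)) = 0) (a : A) :
    a ∈ LinearMap.range (generatorMap π) ↔ ε a = 0 := by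
  constructor
  · rintro ⟨b, rfl⟩
    simp [generatorMap_apply, hε]
  · intro ha
    obtain ⟨f, rfl⟩ := hπ a
    have hcomp : ε.comp π = lift k (fun _ : X => (0 : k)) := by
      ext j
      simp [hε]
    have hf : lift k (fun _ : X => (0 : k)) f = 0 := by
      rw [← hcomp]; exact ha
    refine ⟨fun j => π (rightDeriv k j f), ?_⟩
    conv_rhs => rw [eq_sum_rightDeriv f, hf]
    simp [generatorMap_apply]

namespace NonoverlappingFamily

variable (R : NonoverlappingFamily k X I)

lemma relationMap_injective (π : FreeAlgebra k X →ₐ[k] A) (hπ : Function.Surjective π)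
    (hker : ∀ f, π f = 0 ↔ f ∈ R.idealSpan)
    (h0 : ∀ i, lift k (fun _ : X => (0 : k)) (R.elt i) = 0) :
    Function.Injective (relationMap π R.elt) := by
  rw [← LinearMap.ker_eq_bot, LinearMap.ker_eq_bot']
  intro b hb
  choose b' hb' using fun i => hπ (b i)
  ext i
  rw [← hb', Pi.zero_apply, hker]
  refine R.mem_idealSpan_of_sum_mul_rightDeriv_mem h0 b' (fun j => ?_) i
  rw [← hker]
  simpa [relationMap_apply, hb'] using congrFun hb j

lemma rightDeriv_mem_range (π : FreeAlgebra k X →ₐ[k] A)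
    (hker : ∀ f, π f = 0 ↔ f ∈ R.idealSpan)
    (h0 : ∀ i, lift k (fun _ : X => (0 : k)) (R.elt i) = 0) {f : FreeAlgebra k X}
    (hf : f ∈ R.idealSpan) :
    (fun j => π (rightDeriv k j f)) ∈ LinearMap.range (relationMap π R.elt) := by
  classical
  induction hf using Submodule.span_induction with
  | mem x hx =>
    obtain ⟨u, i, v, hu, rfl⟩ := hx
    rcases List.eq_nil_or_concat v with rfl | ⟨v, l, rfl⟩
    · refine ⟨Pi.single i (π (word k u)), ?_⟩
      ext j
      simp [relationMap, Fintype.linearCombination_apply_single, rightDeriv_mul j _ _ (h0 i)]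
    · have h : word k u * R.elt i * word k (v.concat l) =
          word k u * R.elt i * word k v * ι k l := by
        simp [List.concat_eq_append, word, mul_assoc]
      have hz : π (word k u * R.elt i * word k v) = 0 :=
        (hker _).2 (R.idealSpan_mul_mem (R.mul_elt_mem _ _) _)
      convert zero_mem (LinearMap.range (relationMap π R.elt))
      rw [h, rightDeriv_mul_ι]
      split_ifs
      · exact hz
      · simp
  | zero =>
    convert zero_mem (LinearMap.range (relationMap π R.elt))
    simp
  | add x y _ _ hx hy =>
    convert add_mem hx hy using 1
    ext j
    simp
  | smul c x _ hx =>
    convert Submodule.smul_mem _ (algebraMap k A c) hx using 1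
    ext j
    simp [← Algebra.smul_def]

lemma range_relationMap (π : FreeAlgebra k X →ₐ[k] A) (hπ : Function.Surjective π)
    (hker : ∀ f, π f = 0 ↔ f ∈ R.idealSpan)
    (h0 : ∀ i, lift k (fun _ : X => (0 : k)) (R.elt i) = 0) :
    LinearMap.range (relationMap π R.elt) = LinearMap.ker (generatorMap π) := by
  apply le_antisymm
  · rintro _ ⟨b, rfl⟩
    have h : ∀ i, ∑ j, π (rightDeriv k j (R.elt i)) * π (ι k j) = 0 := fun i => by
      have := (hker _).2 (R.elt_mem i)
      rw [R.elt_eq_sum h0 i] at this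
      simpa using this
    rw [LinearMap.mem_ker, generatorMap_apply]
    simp only [relationMap_apply, Finset.sum_mul]
    rw [Finset.sum_comm]
    simp [mul_assoc, ← Finset.mul_sum, h]
  · intro a ha
    choose a' ha' using fun j => hπ (a j)
    have hmem : ∑ j, a' j * ι k j ∈ R.idealSpan := by
      rw [← hker]
      simpa [generatorMap_apply, ha'] using ha
    have := R.rightDeriv_mem_range π hker h0 hmem
    simpa only [rightDeriv_sum, ha'] using this

end NonoverlappingFamily

lemma LinearMap.exists_comp_eq_of_injective {A L P Q : Type*} [Ring A] [AddCommGroup L]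
    [AddCommGroup P] [AddCommGroup Q] [Module A L] [Module A P] [Module A Q] {f : P →ₗ[A] Q}
    (hf : Function.Injective f) (g : L →ₗ[A] Q) (h : ∀ x, g x ∈ LinearMap.range f) :
    ∃ g' : L →ₗ[A] P, ∀ x, f (g' x) = g x := by
  refine ⟨(LinearEquiv.ofInjective f hf).symm.toLinearMap ∘ₗ g.codRestrict _ h, fun x => ?_⟩
  exact congrArg Subtype.val ((LinearEquiv.ofInjective f hf).apply_symm_apply ⟨g x, h x⟩)

lemma Module.Projective.exists_lift_of_range_le {A L P Q : Type*} [Ring A] [AddCommGroup L]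
    [AddCommGroup P] [AddCommGroup Q] [Module A L] [Module A P] [Module A Q]
    [Module.Projective A L] (f : P →ₗ[A] Q) (g : L →ₗ[A] Q) (h : ∀ x, g x ∈ LinearMap.range f) :
    ∃ g' : L →ₗ[A] P, ∀ x, f (g' x) = g x := by
  obtain ⟨g', hg'⟩ := Module.projective_lifting_property f.rangeRestrict
    (g.codRestrict _ h) f.surjective_rangeRestrict
  exact ⟨g', fun x => congrArg Subtype.val (LinearMap.congr_fun hg' x)⟩

/-- If a module with projective dimension at most one has a length two projective resolution,
then the last differential of this resolution is a split monomorphism. -/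
lemma HasProjDimLE1.exists_retraction_s1 {A : Type} [Ring A] {M : Type u} [AddCommGroup M]
    [Module A M] (hM : HasProjDimLE1 A M) {F₂ F₁ F₀ : Type*} [AddCommGroup F₂] [Module A F₂]
    [AddCommGroup F₁] [Module A F₁] [AddCommGroup F₀] [Module A F₀] [Module.Projective A F₀]
    (d₂ : F₂ →ₗ[A] F₁) (d₁ : F₁ →ₗ[A] F₀) (d₀ : F₀ →ₗ[A] M) (h₂ : Function.Injective d₂)
    (h₁ : LinearMap.range d₂ = LinearMap.ker d₁) (h₀ : LinearMap.range d₁ = LinearMap.ker d₀)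
    (hd₀ : Function.Surjective d₀) : ∃ ρ : F₁ →ₗ[A] F₂, ρ ∘ₗ d₂ = LinearMap.id := by
  obtain ⟨P₁, P₀, hP₁, hP₀, f₁, f₀, hf₁, hf, hf₀⟩ := hM
  obtain ⟨α, hα⟩ := Module.projective_lifting_property f₀ d₀ hf₀
  obtain ⟨β, hβ⟩ := Module.projective_lifting_property d₀ f₀ hd₀
  replace hα := LinearMap.congr_fun hα
  replace hβ := LinearMap.congr_fun hβ
  simp only [LinearMap.comp_apply] at hα hβ
  have hd : ∀ v, d₀ (d₁ v) = 0 := fun v =>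
    LinearMap.mem_ker.1 (h₀ ▸ LinearMap.mem_range_self d₁ v)
  have hd' : ∀ v, d₁ (d₂ v) = 0 := fun v =>
    LinearMap.mem_ker.1 (h₁ ▸ LinearMap.mem_range_self d₂ v)
  have hff : ∀ v, f₀ (f₁ v) = 0 := fun v =>
    LinearMap.mem_ker.1 (hf ▸ LinearMap.mem_range_self f₁ v)
  obtain ⟨γ, hγ⟩ := Module.Projective.exists_lift_of_range_le d₁ (β ∘ₗ f₁)
    (fun x => by simp [h₀, hβ, hff])
  obtain ⟨δ, hδ⟩ := Module.Projective.exists_lift_of_range_le d₁ (LinearMap.id - β ∘ₗ α)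
    (fun x => by simp [h₀, hβ, hα])
  obtain ⟨τ, hτ⟩ := LinearMap.exists_comp_eq_of_injective hf₁ (α ∘ₗ d₁)
    (fun x => by simp [hf, hα, hd])
  obtain ⟨ρ, hρ⟩ := LinearMap.exists_comp_eq_of_injective h₂
    (LinearMap.id - γ ∘ₗ τ - δ ∘ₗ d₁)
    (fun x => by simp [h₁, hγ, hδ, hτ])
  refine ⟨ρ, LinearMap.ext fun b => h₂ ?_⟩
  have hτ0 : τ (d₂ b) = 0 := hf₁ (by simp [hτ, hd'])
  simp [hρ, hτ0, hd']

end Resolution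

section CubicRelations

open FreeAlgebra

/-- A digit attached to each generator, making the generators whose index is divisible by three
larger than the other ones. -/
def letterDigit {n : ℕ} (j : Fin n) : ℕ := if j.val % 3 = 0 then n + j.val else j.val

lemma letterDigit_lt {n : ℕ} (j : Fin n) : letterDigit j < 2 * n := by
  have := j.isLt
  unfold letterDigit
  split_ifs <;> omega

lemma letterDigit_injective {n : ℕ} : Function.Injective (letterDigit (n := n)) := by
  intro a b h
  have := a.isLt
  have := b.isLt
  apply Fin.ext
  unfold letterDigit at h
  split_ifs at h <;> omega

/-- The number whose base `2 * n` expansion is given by the digits of the letters, the first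
letter being the most significant one. -/
def wordWeight {n : ℕ} (w : List (Fin n)) : ℕ :=
  Nat.ofDigits (2 * n) (w.reverse.map letterDigit)

lemma wordWeight_append {n : ℕ} (u v : List (Fin n)) :
    wordWeight (u ++ v) = wordWeight v + (2 * n) ^ v.length * wordWeight u := by
  simp [wordWeight, Nat.ofDigits_append]

lemma wordWeight_append_lt {n : ℕ} (hn : 0 < n) {m m' : List (Fin n)}
    (hlen : m.length = m'.length) (h : wordWeight m < wordWeight m') (u v : List (Fin n)) :
    wordWeight (u ++ m ++ v) < wordWeight (u ++ m' ++ v) := by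
  simp only [wordWeight_append, hlen]
  gcongr

lemma wordWeight_triple {n : ℕ} (a b c : Fin n) : wordWeight [a, b, c] =
    letterDigit c + 2 * n * (letterDigit b + 2 * n * letterDigit a) := by
  simp [wordWeight, Nat.ofDigits_cons]

lemma wordWeight_triple_injective {n : ℕ} {a b c a' b' c' : Fin n}
    (h : wordWeight [a, b, c] = wordWeight [a', b', c']) : a = a' ∧ b = b' ∧ c = c' := by
  have hinj : ([c, b, a].map letterDigit) = ([c', b', a'].map letterDigit) := by
    refine Nat.ofDigits_inj_of_len_eq (b := 2 * n) ?_ (by simp) ?_ ?_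
      (by simpa [wordWeight] using h)
    · have := a.isLt
      omega
    · simp [letterDigit_lt]
    · simp [letterDigit_lt]
  have := letterDigit_injective.list_map hinj
  simp at this
  tauto

lemma wordWeight_lt_of_head {n : ℕ} {a b c a' b' c' : Fin n} (ha : a.val % 3 ≠ 0)
    (ha' : a'.val % 3 = 0) : wordWeight [a, b, c] < wordWeight [a', b', c'] := by
  rw [wordWeight_triple, wordWeight_triple]
  have hlt : letterDigit a + 1 ≤ letterDigit a' := by
    have := a.isLt
    simp only [letterDigit, ha, ha', if_true, if_false]
    omega
  have h1 := letterDigit_lt b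
  have h2 := letterDigit_lt c
  have h3 : letterDigit b + 2 * n * letterDigit a + 1 ≤ 2 * n * letterDigit a' := by
    nlinarith
  nlinarith

/-- The word `x_{i+σ(0)} x_{i+σ(1)} x_{i+σ(2)}`. -/
def permWord (n : ℕ) (i : Fin (n - 2)) (σ : Equiv.Perm (Fin 3)) : List (Fin n) :=
  [genIdx n i (σ 0), genIdx n i (σ 1), genIdx n i (σ 2)]

lemma rel_eq_sum_word (k : Type) [Field k] (n : ℕ) (c : Equiv.Perm (Fin 3) → k)
    (i : Fin (n - 2)) : rel k n c i = ∑ σ, c σ • word k (permWord n i σ) := by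
  simp [rel, word, permWord, mul_assoc]

lemma genIdx_injective (n : ℕ) (i : Fin (n - 2)) : Function.Injective (genIdx n i) := by
  intro s t h
  simp only [genIdx, Fin.mk.injEq] at h
  exact Fin.ext (by omega)

lemma permWord_injective_of_weight (n : ℕ) (i : Fin (n - 2)) {σ τ : Equiv.Perm (Fin 3)}
    (h : wordWeight (permWord n i σ) = wordWeight (permWord n i τ)) : σ = τ := by
  obtain ⟨h0, h1, h2⟩ := wordWeight_triple_injective h
  ext t
  fin_cases t
  · exact congrArg Fin.val (genIdx_injective n i h0)
  · exact congrArg Fin.val (genIdx_injective n i h1)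
  · exact congrArg Fin.val (genIdx_injective n i h2)

lemma permWord_inj_left {n : ℕ} {i i' : Fin (n - 2)} {σ τ : Equiv.Perm (Fin 3)}
    (h : permWord n i σ = permWord n i' τ) : i = i' := by
  have hsum : ∀ ρ : Equiv.Perm (Fin 3), (ρ 0).val + (ρ 1).val + (ρ 2).val = 3 := by decide
  have h1 := hsum σ
  have h2 := hsum τ
  simp only [permWord, genIdx, List.cons.injEq, Fin.mk.injEq] at h
  exact Fin.ext (by omega)

lemma exists_leading_perm {k : Type} [Field k] (n : ℕ) (c : Equiv.Perm (Fin 3) → k)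
    (hc : ∀ a : Fin 3, ∃ σ : Equiv.Perm (Fin 3), σ 0 = a ∧ c σ ≠ 0) (i : Fin (n - 2)) :
    ∃ σ : Equiv.Perm (Fin 3), c σ ≠ 0 ∧ (genIdx n i (σ 0)).val % 3 = 0 ∧
      ∀ τ, c τ ≠ 0 → τ ≠ σ → wordWeight (permWord n i τ) < wordWeight (permWord n i σ) := by
  classical
  obtain ⟨t, ht⟩ : ∃ t : Fin 3, (genIdx n i t).val % 3 = 0 :=
    ⟨⟨(3 - i.val % 3) % 3, Nat.mod_lt _ (by norm_num)⟩, by simp only [genIdx]; omega⟩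
  obtain ⟨σ₀, hσ₀, hcσ₀⟩ := hc t
  obtain ⟨σ, hσ, hmax⟩ := Finset.exists_max_image (Finset.univ.filter fun σ => c σ ≠ 0)
    (fun σ => wordWeight (permWord n i σ)) ⟨σ₀, by simpa using hcσ₀⟩
  simp only [Finset.mem_filter, Finset.mem_univ, true_and] at hσ hmax
  refine ⟨σ, hσ, ?_, fun τ hτ hne => lt_of_le_of_ne (hmax τ hτ) fun h =>
    hne (permWord_injective_of_weight n i h)⟩
  by_contra h
  exact absurd (hmax σ₀ hcσ₀) (not_le.2 (wordWeight_lt_of_head h (hσ₀ ▸ ht)))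

lemma genIdx_mod_three_ne_zero {n : ℕ} {i : Fin (n - 2)} {s t : Fin 3} (hst : s ≠ t)
    (hs : (genIdx n i s).val % 3 = 0) : (genIdx n i t).val % 3 ≠ 0 := by
  have := Fin.val_ne_of_ne hst
  simp only [genIdx] at *
  omega

/-- Words of length three starting with a letter not occurring in the tails of the other ones
do not overlap. -/
lemma unique_factorization_of_triples {X I : Type} (S : X → Prop) (ℓ : I → List X)
    (hinj : Function.Injective ℓ)
    (hℓ : ∀ i, ∃ p q r, ℓ i = [p, q, r] ∧ S p ∧ ¬ S q ∧ ¬ S r) :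
    ∀ (u u' v v' : List X) (i i' : I), (∀ a j b, u ≠ a ++ ℓ j ++ b) →
      (∀ a j b, u' ≠ a ++ ℓ j ++ b) → u ++ ℓ i ++ v = u' ++ ℓ i' ++ v' →
      u = u' ∧ i = i' ∧ v = v' := by
  have key : ∀ (u v v' : List X) (i i' : I) (x : X), (∀ a j b, x :: u ≠ a ++ ℓ j ++ b) →
      ℓ i ++ v ≠ x :: u ++ ℓ i' ++ v' := by
    intro u v v' i i' x hu h
    obtain ⟨p, q, r, hi, hp, hq, hr⟩ := hℓ i
    obtain ⟨p', q', r', hi', hp', hq', hr'⟩ := hℓ i'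
    rcases u with _ | ⟨y, _ | ⟨z, u⟩⟩
    · simp [hi, hi'] at h
      exact hq (h.2.1 ▸ hp')
    · simp [hi, hi'] at h
      exact hr (h.2.2.1 ▸ hp')
    · simp only [hi, List.cons_append, List.cons.injEq] at h
      refine hu [] i u ?_
      simp [hi, h.1, h.2.1, h.2.2.1]
  intro u
  induction u with
  | nil =>
    intro u' v v' i i' _ hu' h
    rcases u' with _ | ⟨x, u'⟩
    · obtain ⟨p, q, r, hi, -⟩ := hℓ i
      obtain ⟨p', q', r', hi', -⟩ := hℓ i'
      have := List.append_inj (by simpa using h) (by simp [hi, hi'])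
      exact ⟨rfl, hinj this.1, this.2⟩
    · exact absurd (by simpa using h) (key u' v v' i i' x hu')
  | cons x u ih =>
    intro u' v v' i i' hu hu' h
    rcases u' with _ | ⟨y, u'⟩
    · exact absurd (by simpa using h.symm) (key u v' v i' i x hu)
    · simp only [List.cons_append, List.cons.injEq] at h
      obtain ⟨rfl, h⟩ := h
      obtain ⟨rfl, h1, h2⟩ := ih u' v v' i i'
        (fun a j b hab => hu (x :: a) j b (by simp [hab]))
        (fun a j b hab => hu' (x :: a) j b (by simp [hab])) h
      exact ⟨rfl, h1, h2⟩

variable (k : Type) [Field k] (n : ℕ) (c : Equiv.Perm (Fin 3) → k)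
  (hc : ∀ a : Fin 3, ∃ σ : Equiv.Perm (Fin 3), σ 0 = a ∧ c σ ≠ 0)

/-- The permutation giving the leading word of the `i`-th relation. -/
def leadingPerm (i : Fin (n - 2)) : Equiv.Perm (Fin 3) :=
  (exists_leading_perm n c hc i).choose

lemma leadingPerm_spec (i : Fin (n - 2)) : c (leadingPerm k n c hc i) ≠ 0 ∧
    (genIdx n i (leadingPerm k n c hc i 0)).val % 3 = 0 ∧
      ∀ τ, c τ ≠ 0 → τ ≠ leadingPerm k n c hc i →
        wordWeight (permWord n i τ) < wordWeight (permWord n i (leadingPerm k n c hc i)) :=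
  (exists_leading_perm n c hc i).choose_spec

/-- The cubic relations, normalized, with their leading words. -/
def cubicFamily : NonoverlappingFamily k (Fin n) (Fin (n - 2)) where
  lead i := permWord n i (leadingPerm k n c hc i)
  elt i := (c (leadingPerm k n c hc i))⁻¹ • rel k n c i
  weight := wordWeight
  lead_ne_nil i := by simp [permWord]
  elt_sub_lead_mem i := by
    obtain ⟨h1, -, h3⟩ := leadingPerm_spec k n c hc i
    rw [rel_eq_sum_word, ← Finset.add_sum_erase _ _ (Finset.mem_univ (leadingPerm k n c hc i)),
      smul_add, smul_smul, inv_mul_cancel₀ h1, one_smul, add_sub_cancel_left]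
    refine Submodule.smul_mem _ _ (Submodule.sum_mem _ fun τ hτ => ?_)
    by_cases hcτ : c τ = 0
    · simp [hcτ]
    · refine Submodule.smul_mem _ _ (Submodule.subset_span ⟨_, ?_, rfl⟩)
      exact wordWeight_append_lt (by have := i.isLt; omega) (by simp [permWord])
        (h3 τ hcτ (Finset.ne_of_mem_erase hτ))
  unique_factorization := by
    refine unique_factorization_of_triples (fun x => x.val % 3 = 0) _
      (fun i i' h => permWord_inj_left h) fun i => ⟨_, _, _, rfl, ?_⟩
    have h := (leadingPerm_spec k n c hc i).2.1
    exact ⟨h, genIdx_mod_three_ne_zero (by simp) h, genIdx_mod_three_ne_zero (by simp) h⟩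

lemma lift_zero_cubicFamily (i : Fin (n - 2)) :
    lift k (fun _ : Fin n => (0 : k)) ((cubicFamily k n c hc).elt i) = 0 := by
  simp [cubicFamily, rel]

lemma lift_zero_rightDeriv_cubicFamily (i : Fin (n - 2)) (j : Fin n) :
    lift k (fun _ : Fin n => (0 : k)) (rightDeriv k j ((cubicFamily k n c hc).elt i)) = 0 := by
  simp only [cubicFamily, rel, map_smul, map_sum, rightDeriv_mul_ι]
  rw [Finset.sum_eq_zero, smul_zero]
  intro σ _
  split_ifs <;> simp

lemma mkAlgHom_eq_zero_iff (f : FreeAlgebra k (Fin n)) :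
    RingQuot.mkAlgHom k (relRel k n c) f = 0 ↔ f ∈ (cubicFamily k n c hc).idealSpan := by
  set R := cubicFamily k n c hc with hR
  constructor
  · let J : TwoSidedIdeal (FreeAlgebra k (Fin n)) := TwoSidedIdeal.mk' R.idealSpan
      (zero_mem _) (fun hx hy => add_mem hx hy) (fun hx => neg_mem hx)
      (fun hy => R.mul_idealSpan_mem _ hy) (fun hx => R.idealSpan_mul_mem hx _)
    have hJ : ∀ x, J.ringCon.mk' x = 0 ↔ x ∈ R.idealSpan := fun x => by
      have h1 : x ∈ J ↔ x ∈ R.idealSpan := TwoSidedIdeal.mem_mk' _ _ _ _ _ _ _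
      rw [← h1, TwoSidedIdeal.mem_iff, ← RingCon.eq]
      rfl
    have hrel : ∀ ⦃x y⦄, relRel k n c x y → J.ringCon.mk' x = J.ringCon.mk' y := by
      rintro x y ⟨rfl, i, rfl⟩
      rw [map_zero, hJ]
      have h1 := Submodule.smul_mem _ (c (leadingPerm k n c hc i)) (R.elt_mem i)
      rwa [hR, cubicFamily, smul_smul, mul_inv_cancel₀ (leadingPerm_spec k n c hc i).1,
        one_smul] at h1
    intro hf
    have hf' : RingQuot.mkRingHom (relRel k n c) f = 0 := by
      rw [← RingQuot.mkAlgHom_coe k]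
      exact hf
    rw [← hJ, ← RingQuot.lift_mkRingHom_apply J.ringCon.mk' hrel, hf', map_zero]
  · intro hf
    have : R.idealSpan ≤ LinearMap.ker (RingQuot.mkAlgHom k (relRel k n c)).toLinearMap := by
      rw [NonoverlappingFamily.idealSpan, Submodule.span_le]
      rintro _ ⟨u, i, v, -, rfl⟩
      have h : RingQuot.mkAlgHom k (relRel k n c) (rel k n c i) = 0 := by
        rw [RingQuot.mkAlgHom_rel k (show relRel k n c _ 0 from ⟨rfl, i, rfl⟩), map_zero]
      simp [hR, cubicFamily, h]
    exact this hf

end CubicRelations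

/-- under the coefficient condition, the trivial `A`-module `k` (with action
through the augmentation `ε : A → k`) has projective dimension exactly 2. -/
theorem trivial_module_projdim_eq_two
    (k : Type) [Field k] (n : ℕ) (hn : 3 ≤ n)
    (c : Equiv.Perm (Fin 3) → k)
    (hc : ∀ a : Fin 3, ∃ σ : Equiv.Perm (Fin 3), σ 0 = a ∧ c σ ≠ 0) :
    letI : Module (QuotAlg k n c) k := Module.compHom k (aug k n c).toRingHom
    HasProjDimLE2 (QuotAlg k n c) k ∧ ¬ HasProjDimLE1 (QuotAlg k n c) k := by
  let : Module (QuotAlg k n c) k := Module.compHom k (aug k n c).toRingHom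
  let π := RingQuot.mkAlgHom k (relRel k n c)
  let R := cubicFamily k n c hc
  have hπ : Function.Surjective π := RingQuot.mkAlgHom_surjective k _
  have hker : ∀ f, π f = 0 ↔ f ∈ R.idealSpan := mkAlgHom_eq_zero_iff k n c hc
  have h0 := lift_zero_cubicFamily k n c hc
  have hπε : ∀ f, aug k n c (π f) = FreeAlgebra.lift k (fun _ : Fin n => (0 : k)) f :=
    fun f => RingQuot.liftAlgHom_mkAlgHom_apply k _ _ f
  let d₀ : QuotAlg k n c →ₗ[QuotAlg k n c] k :=
    { toFun := aug k n c
      map_add' := map_add _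
      map_smul' := fun a b => map_mul (aug k n c) a b }
  have hd₀ : Function.Surjective d₀ := fun x =>
    ⟨algebraMap k _ x, (aug k n c).commutes x⟩
  have hinj := R.relationMap_injective π hπ hker h0
  have h₁ := R.range_relationMap π hπ hker h0
  have h₀ : LinearMap.range (generatorMap π) = LinearMap.ker d₀ := by
    ext a
    exact range_generatorMap π hπ (aug k n c) (fun j => by simp [hπε]) a
  refine ⟨⟨ModuleCat.of _ (Fin (n - 2) → QuotAlg k n c), ModuleCat.of _ (Fin n → QuotAlg k n c),
    ModuleCat.of _ (QuotAlg k n c), inferInstance, inferInstance, inferInstance,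
    relationMap π R.elt, generatorMap π, d₀, hinj, h₁, h₀, hd₀⟩, fun h => ?_⟩
  obtain ⟨ρ, hρ⟩ := h.exists_retraction_s1 (relationMap π R.elt) (generatorMap π) d₀ hinj h₁ h₀ hd₀
  let i : Fin (n - 2) := ⟨0, by omega⟩
  have h1 := LinearMap.congr_fun hρ (Pi.single i 1)
  have h2 : relationMap π R.elt (Pi.single i 1) =
      ∑ j, π (FreeAlgebra.rightDeriv k j (R.elt i)) • Pi.single j (1 : QuotAlg k n c) := by
    ext j
    simp [relationMap, Fintype.linearCombination_apply_single, Pi.single_apply]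
  rw [LinearMap.comp_apply, h2, map_sum] at h1
  have h3 := congrArg (aug k n c) (congrFun h1 i)
  simp [hπε, R, lift_zero_rightDeriv_cubicFamily] at h3

end
end
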